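/- Let K be a number field and D ∈ S_K with deg D = 2d. Then K(T, √D) contains infinitely many pairwise non-equivalent elements α ∉ K(T) with K(α) = 1; moreover, if D is non-Pellian, there exist λ_1, …, λ_{d−1} ∈ K such that ōK((T − λ_1)⋯(T − λ_{d−1})·√D) = 1, i.e. all but finitely many partial quotients of (T − λ_1)⋯(T − λ_{d−1})·√D have degree 1. In particular, McMullen's strong conjecture holds over every number field. -/

import Mathlib

noncomputable section

namespace PaperCF

variable {K : Type*} [Field K]

/-- The element `T` of `K((T⁻¹))`, where `K((T⁻¹))` is modeled as the field
`LaurentSeries K` of Laurent series in the variable `t = T⁻¹`. -/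
def Tvar (K : Type*) [Field K] : LaurentSeries K := (HahnSeries.single (-1 : ℤ) (1 : K))

/-- The embedding of `K[T]` into `K((T⁻¹))`, sending the polynomial variable to `T = t⁻¹`. -/
def emb : Polynomial K →+* LaurentSeries K := (Polynomial.aeval (Tvar K)).toRingHom

/-- The polynomial part `⌊α⌋` of a formal Laurent series `α ∈ K((T⁻¹))`. -/
def polyPart (α : LaurentSeries K) : Polynomial K :=
  ∑ i ∈ Finset.range ((-α.order).toNat + 1), Polynomial.monomial i (α.coeff (-(i : ℤ)))

/-- The complete quotients `αₙ` of the regular continued fraction expansion of `α`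
(with the convention `0⁻¹ = 0`, so that `cq α n = 0` for all `n` past the end of a
finite expansion). -/
def cq (α : LaurentSeries K) : ℕ → LaurentSeries K
  | 0 => α
  | n + 1 => (cq α n - emb (polyPart (cq α n)))⁻¹

/-- The partial quotients `aₙ = ⌊αₙ⌋` of the regular continued fraction expansion of `α`. -/
def pq (α : LaurentSeries K) (n : ℕ) : Polynomial K := polyPart (cq α n)

/-- The continuants `(pₙ, qₙ)` of the regular continued fraction expansion of `α`. -/
def cont (α : LaurentSeries K) : ℕ → Polynomial K × Polynomial K
  | 0 => (pq α 0, 1)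
  | 1 => (pq α 1 * pq α 0 + 1, pq α 1)
  | n + 2 => (pq α (n + 2) * (cont α (n + 1)).1 + (cont α n).1,
              pq α (n + 2) * (cont α (n + 1)).2 + (cont α n).2)

/-- `pₙ`. -/
def contP (α : LaurentSeries K) (n : ℕ) : Polynomial K := (cont α n).1

/-- `qₙ`. -/
def contQ (α : LaurentSeries K) (n : ℕ) : Polynomial K := (cont α n).2

/-- The `n`-th partial quotient (and hence the `n`-th convergent) of `α` genuinely exists. -/
def ConvAt (α : LaurentSeries K) (n : ℕ) : Prop := n = 0 ∨ cq α n ≠ 0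

/-- `K(α) = sup_{n ≥ 1} deg aₙ`, as an extended natural number. -/
def KK (α : LaurentSeries K) : ℕ∞ :=
  ⨆ n : {n : ℕ // 1 ≤ n ∧ cq α n ≠ 0}, ((pq α n.1).natDegree : ℕ∞)

/-- `ōK(α) = limsup_n deg aₙ`. -/
def KKbar (α : LaurentSeries K) : ℕ∞ :=
  Filter.limsup (fun n => ((pq α n).natDegree : ℕ∞)) Filter.atTop

/-- `α` is a rational function, i.e. an element of `K(T) ⊆ K((T⁻¹))`. -/
def IsRat (α : LaurentSeries K) : Prop :=
  ∃ p q : Polynomial K, q ≠ 0 ∧ α * emb q = emb p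

/-- Two Laurent series are equivalent if they differ by a Möbius transformation with
matrix in `GL₂(K[T])`. -/
def MEquiv (α β : LaurentSeries K) : Prop :=
  ∃ a b c d : Polynomial K, IsUnit (a * d - b * c) ∧
    emb c * α + emb d ≠ 0 ∧ β = (emb a * α + emb b) / (emb c * α + emb d)

end PaperCF

namespace PaperCF

/-- `D` is Pellian: the polynomial Pell equation `x² − D y² ∈ K \ {0}` has a solution
with `y ≠ 0`. -/
def Pellian {K : Type*} [Field K] (D : Polynomial K) : Prop :=
  ∃ (x y : Polynomial K) (c : K), y ≠ 0 ∧ c ≠ 0 ∧ x ^ 2 - D * y ^ 2 = Polynomial.C c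

end PaperCF

namespace LaurentCF

open PaperCF

section Basics

variable {S : Type*} [CommRing S]

/-- All coefficients of exponent less than `a` (in `t = T⁻¹`) vanish. -/
def OrdGe (a : ℤ) (f : LaurentSeries S) : Prop := ∀ i < a, f.coeff i = 0

/-- `f` is a polynomial in `T = t⁻¹`. -/
def IsPoly (f : LaurentSeries S) : Prop := ∀ i, 0 < i → f.coeff i = 0

theorem OrdGe.mono {a b : ℤ} {f : LaurentSeries S} (h : OrdGe b f) (hab : a ≤ b) : OrdGe a f :=
  fun i hi => h i (by omega)

theorem OrdGe.add {a : ℤ} {f g : LaurentSeries S} (hf : OrdGe a f) (hg : OrdGe a g) :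
    OrdGe a (f + g) := fun i hi => by simp [hf i hi, hg i hi]

theorem OrdGe.neg {a : ℤ} {f : LaurentSeries S} (hf : OrdGe a f) :
    OrdGe a (-f) := fun i hi => by simp [hf i hi]

theorem OrdGe.sub {a : ℤ} {f g : LaurentSeries S} (hf : OrdGe a f) (hg : OrdGe a g) :
    OrdGe a (f - g) := fun i hi => by simp [hf i hi, hg i hi]

theorem OrdGe.mul {a b : ℤ} {f g : LaurentSeries S} (hf : OrdGe a f) (hg : OrdGe b g) :
    OrdGe (a + b) (f * g) := fun i hi => by
  rw [HahnSeries.coeff_mul]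
  refine Finset.sum_eq_zero fun x hx => ?_
  rw [Finset.mem_antidiagonal] at hx
  rcases lt_or_ge x.1 a with h | h
  · rw [hf _ h, zero_mul]
  · rw [hg x.2 (by omega), mul_zero]

theorem ordGe_zero (a : ℤ) : OrdGe a (0 : LaurentSeries S) := fun i _ => by simp

theorem ordGe_one : OrdGe 0 (1 : LaurentSeries S) := fun i hi => by
  rw [HahnSeries.coeff_one, if_neg (by omega)]

theorem OrdGe.pow {a : ℤ} {f : LaurentSeries S} (hf : OrdGe a f) (n : ℕ) :
    OrdGe (n * a) (f ^ n) := by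
  induction n with
  | zero => simpa using ordGe_one
  | succ n ih =>
    rw [pow_succ]
    exact (ih.mul hf).mono (by push_cast; linarith)

theorem ordGe_order {f : LaurentSeries S} : OrdGe f.order f := fun _ hi =>
  HahnSeries.coeff_eq_zero_of_lt_order hi

theorem ordGe_single (a : ℤ) (r : S) : OrdGe a (HahnSeries.single a r : LaurentSeries S) :=
  fun i hi => HahnSeries.coeff_single_of_ne (by omega)

theorem OrdGe.sum {a : ℤ} {ι : Type*} (s : Finset ι) (f : ι → LaurentSeries S)
    (h : ∀ i ∈ s, OrdGe a (f i)) : OrdGe a (∑ i ∈ s, f i) := fun i hi => by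
  rw [HahnSeries.coeff_sum]
  exact Finset.sum_eq_zero fun j hj => h j hj i hi

theorem coeff_mul_of_ordGe {a b : ℤ} {f g : LaurentSeries S} (hf : OrdGe a f) (hg : OrdGe b g) :
    (f * g).coeff (a + b) = f.coeff a * g.coeff b := by
  rw [HahnSeries.coeff_mul]
  rw [Finset.sum_eq_single (a, b)]
  · intro x hx hne
    rw [Finset.mem_antidiagonal] at hx
    rcases lt_trichotomy x.1 a with h | h | h
    · rw [hf _ h, zero_mul]
    · exact absurd (Prod.ext h (by simp only; omega)) hne
    · rw [hg x.2 (by omega), mul_zero]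
  · intro h
    rw [Finset.mem_antidiagonal] at h
    simp only [HahnSeries.mem_support, ne_eq, and_true] at h
    by_cases h1 : f.coeff a = 0
    · simp [h1]
    · by_cases h2 : g.coeff b = 0
      · simp [h2]
      · exact absurd ⟨h1, h2⟩ h

theorem IsPoly.add {f g : LaurentSeries S} (hf : IsPoly f) (hg : IsPoly g) :
    IsPoly (f + g) := fun i hi => by simp [hf i hi, hg i hi]

theorem IsPoly.neg {f : LaurentSeries S} (hf : IsPoly f) :
    IsPoly (-f) := fun i hi => by simp [hf i hi]

theorem IsPoly.sub {f g : LaurentSeries S} (hf : IsPoly f) (hg : IsPoly g) :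
    IsPoly (f - g) := fun i hi => by simp [hf i hi, hg i hi]

theorem IsPoly.mul {f g : LaurentSeries S} (hf : IsPoly f) (hg : IsPoly g) :
    IsPoly (f * g) := fun i hi => by
  rw [HahnSeries.coeff_mul]
  refine Finset.sum_eq_zero fun x hx => ?_
  rw [Finset.mem_antidiagonal] at hx
  rcases lt_or_ge 0 x.1 with h | h
  · rw [hf _ h, zero_mul]
  · rw [hg x.2 (by omega), mul_zero]

theorem isPoly_zero : IsPoly (0 : LaurentSeries S) := fun i _ => by simp

theorem isPoly_one : IsPoly (1 : LaurentSeries S) := fun i hi => by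
  rw [HahnSeries.coeff_one, if_neg (by omega)]

theorem isPoly_C (r : S) : IsPoly (HahnSeries.C r : LaurentSeries S) := fun i hi => by
  rw [HahnSeries.C_apply, HahnSeries.coeff_single_of_ne (by omega)]

/-- The subring of polynomials in `T = t⁻¹`. -/
def polySubring (S : Type*) [CommRing S] : Subring (LaurentSeries S) where
  carrier := {f | IsPoly f}
  mul_mem' := IsPoly.mul
  one_mem' := isPoly_one
  add_mem' := IsPoly.add
  zero_mem' := isPoly_zero
  neg_mem' := IsPoly.neg

theorem IsPoly.eq_zero {f : LaurentSeries S} (hf : IsPoly f) (h : OrdGe 1 f) : f = 0 := by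
  ext i
  rcases lt_or_ge 0 i with hi | hi
  · simp [hf i hi]
  · simp [h i (by omega)]

/-- Truncation: keep the coefficients of exponent at most `c`. -/
def trunc (c : ℤ) : LaurentSeries S →ₗ[S] LaurentSeries S where
  toFun f := ⟨fun i => if i ≤ c then f.coeff i else 0, f.isPWO_support.mono (by
    intro i hi
    simp only [Function.mem_support, ne_eq, ite_eq_right_iff, Classical.not_imp] at hi
    exact hi.2)⟩
  map_add' f g := by ext i; simp only [HahnSeries.coeff_add]; split_ifs <;> simp
  map_smul' r f := by ext i; simp

theorem coeff_trunc (c : ℤ) (f : LaurentSeries S) (i : ℤ) :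
    (trunc c f).coeff i = if i ≤ c then f.coeff i else 0 := rfl

theorem isPoly_trunc (f : LaurentSeries S) : IsPoly (trunc 0 f) := fun i hi => by
  rw [coeff_trunc, if_neg (by omega)]

theorem trunc_of_ordGe {c : ℤ} {f : LaurentSeries S} (h : OrdGe (c + 1) f) : trunc c f = 0 := by
  ext i
  rw [coeff_trunc]
  split_ifs with hi
  · simp [h i (by omega)]
  · simp

theorem ordGe_sub_trunc (c : ℤ) (f : LaurentSeries S) : OrdGe (c + 1) (f - trunc c f) :=
  fun i hi => by simp [coeff_trunc, show i ≤ c by omega]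

theorem IsPoly.trunc_eq {f : LaurentSeries S} (hf : IsPoly f) : trunc 0 f = f := by
  ext i
  rw [coeff_trunc]
  split_ifs with hi
  · rfl
  · exact (hf i (by omega)).symm

theorem trunc_zero_trunc (f : LaurentSeries S) : trunc 0 (trunc 0 f) = trunc 0 f :=
  (isPoly_trunc f).trunc_eq

theorem single_isPoly {n : ℤ} (hn : n ≤ 0) (r : S) :
    IsPoly (HahnSeries.single n r : LaurentSeries S) :=
  fun i hi => HahnSeries.coeff_single_of_ne (by omega)

/-- Coefficientwise application of a ring homomorphism. -/
def mapL {S' : Type*} [CommRing S'] (φ : S →+* S') : LaurentSeries S →+* LaurentSeries S' where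
  toFun f := HahnSeries.map f φ
  map_one' := HahnSeries.map_one φ.toMonoidWithZeroHom
  map_mul' f g := HahnSeries.map_mul φ.toNonUnitalRingHom
  map_zero' := by ext; simp
  map_add' f g := by ext; simp

@[simp]
theorem coeff_mapL {S' : Type*} [CommRing S'] (φ : S →+* S') (f : LaurentSeries S) (i : ℤ) :
    (mapL φ f).coeff i = φ (f.coeff i) := rfl

theorem IsPoly.mapL {S' : Type*} [CommRing S'] (φ : S →+* S') {f : LaurentSeries S}
    (hf : IsPoly f) : IsPoly (LaurentCF.mapL φ f) := fun i hi => by simp [hf i hi]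

theorem OrdGe.mapL {S' : Type*} [CommRing S'] (φ : S →+* S') {f : LaurentSeries S} {a : ℤ}
    (hf : OrdGe a f) : OrdGe a (LaurentCF.mapL φ f) := fun i hi => by simp [hf i hi]

/-- The embedding of `S[T]` in `S((T⁻¹))`. -/
def pemb (S : Type*) [CommRing S] : Polynomial S →+* LaurentSeries S :=
  Polynomial.eval₂RingHom HahnSeries.C (HahnSeries.single (-1) 1)

theorem pemb_monomial (n : ℕ) (r : S) :
    pemb S (Polynomial.monomial n r) = HahnSeries.single (-(n : ℤ)) r := by
  simp only [pemb, Polynomial.coe_eval₂RingHom, Polynomial.eval₂_monomial]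
  rw [HahnSeries.single_pow, HahnSeries.C_apply, HahnSeries.single_mul_single]
  simp

theorem pemb_X : pemb S Polynomial.X = HahnSeries.single (-1) 1 := by
  simp [pemb]

theorem pemb_C (r : S) : pemb S (Polynomial.C r) = HahnSeries.C r := by
  simp [pemb]

theorem isPoly_pemb (P : Polynomial S) : IsPoly (pemb S P) := by
  induction P using Polynomial.induction_on' with
  | add p q hp hq => rw [map_add]; exact hp.add hq
  | monomial n r => rw [pemb_monomial]; exact single_isPoly (by omega) r

theorem coeff_pemb (P : Polynomial S) (n : ℕ) : (pemb S P).coeff (-(n : ℤ)) = P.coeff n := by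
  induction P using Polynomial.induction_on' with
  | add p q hp hq => simp [hp, hq]
  | monomial m r =>
    rw [pemb_monomial, HahnSeries.coeff_single, Polynomial.coeff_monomial]
    simp [eq_comm]

theorem pemb_injective : Function.Injective (pemb S) := fun P Q h => by
  ext n
  rw [← coeff_pemb, ← coeff_pemb, h]

theorem ordGe_pemb (P : Polynomial S) {n : ℕ} (hn : P.natDegree ≤ n) :
    OrdGe (-(n : ℤ)) (pemb S P) := fun i hi => by
  obtain ⟨k, rfl⟩ : ∃ k : ℕ, i = -(k : ℤ) := ⟨i.natAbs, by omega⟩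
  rw [coeff_pemb, Polynomial.coeff_eq_zero_of_natDegree_lt (by omega)]

theorem mapL_pemb {S' : Type*} [CommRing S'] (φ : S →+* S') (P : Polynomial S) :
    mapL φ (pemb S P) = pemb S' (P.map φ) := by
  ext i
  rcases lt_or_ge 0 i with hi | hi
  · rw [isPoly_pemb _ i hi, (isPoly_pemb P).mapL φ i hi]
  · obtain ⟨k, rfl⟩ : ∃ k : ℕ, i = -(k : ℤ) := ⟨i.natAbs, by omega⟩
    rw [coeff_mapL, coeff_pemb, coeff_pemb, Polynomial.coeff_map]

theorem IsPoly.exists_pemb {f : LaurentSeries S} (hf : IsPoly f) : ∃ P, f = pemb S P := by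
  refine ⟨∑ i ∈ Finset.range ((-f.order).toNat + 1),
    Polynomial.monomial i (f.coeff (-(i : ℤ))), ?_⟩
  ext i
  rcases lt_or_ge 0 i with hi | hi
  · rw [isPoly_pemb _ i hi, hf i hi]
  · obtain ⟨k, rfl⟩ : ∃ k : ℕ, i = -(k : ℤ) := ⟨i.natAbs, by omega⟩
    rw [coeff_pemb, Polynomial.finsetSum_coeff]
    simp only [Polynomial.coeff_monomial]
    rw [Finset.sum_ite_eq']
    split_ifs with h
    · rfl
    · rw [Finset.mem_range] at h
      exact ordGe_order _ (by omega)

/-- Every coefficient is divisible by `p`. -/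
def PDvd (p : S) (f : LaurentSeries S) : Prop := ∀ i, p ∣ f.coeff i

theorem pdvd_iff {p : S} {f : LaurentSeries S} : PDvd p f ↔ ∃ g, f = p • g := by
  constructor
  · intro h
    classical
    refine ⟨⟨fun i => if f.coeff i = 0 then 0 else (h i).choose, f.isPWO_support.mono ?_⟩, ?_⟩
    · intro i hi
      simp only [Function.mem_support, ne_eq, ite_eq_left_iff, Classical.not_imp] at hi
      exact hi.1
    · ext i
      simp only [HahnSeries.coeff_smul]
      split_ifs with hi
      · simp [hi]
      · simpa using (h i).choose_spec
  · rintro ⟨g, rfl⟩ i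
    exact ⟨g.coeff i, by simp⟩

theorem PDvd.map {p : S} {f : LaurentSeries S} (h : PDvd p f)
    (O : LaurentSeries S →ₗ[S] LaurentSeries S) : PDvd p (O f) := by
  obtain ⟨g, rfl⟩ := pdvd_iff.1 h
  exact pdvd_iff.2 ⟨O g, by simp⟩

/-- Multiplication by `g` as a linear map. -/
def mulL (g : LaurentSeries S) : LaurentSeries S →ₗ[S] LaurentSeries S where
  toFun f := g * f
  map_add' := mul_add g
  map_smul' r f := by
    rw [RingHom.id_apply, ← HahnSeries.C_mul_eq_smul, ← HahnSeries.C_mul_eq_smul, mul_left_comm]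

@[simp]
theorem mulL_apply (g f : LaurentSeries S) : mulL g f = g * f := rfl

theorem PDvd.mul {p : S} {f : LaurentSeries S} (h : PDvd p f) (g : LaurentSeries S) :
    PDvd p (g * f) := h.map (mulL g)

theorem PDvd.add {p : S} {f g : LaurentSeries S} (hf : PDvd p f) (hg : PDvd p g) :
    PDvd p (f + g) := fun i => by
  rw [HahnSeries.coeff_add]; exact dvd_add (hf i) (hg i)

theorem PDvd.sub {p : S} {f g : LaurentSeries S} (hf : PDvd p f) (hg : PDvd p g) :
    PDvd p (f - g) := fun i => by
  rw [HahnSeries.coeff_sub]; exact dvd_sub (hf i) (hg i)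

/-- A series whose lowest coefficient is a unit is invertible. -/
theorem exists_inv_of_isUnit {a : ℤ} {f : LaurentSeries S} (hf : OrdGe a f)
    (hu : IsUnit (f.coeff a)) : ∃ g : LaurentSeries S, f * g = 1 ∧ OrdGe (-a) g := by
  set U : PowerSeries S := PowerSeries.mk fun n => f.coeff (a + n) with hU
  have hfU : f = HahnSeries.single a 1 * HahnSeries.ofPowerSeries ℤ S U := by
    ext i
    rw [HahnSeries.coeff_single_mul, one_mul]
    rcases lt_or_ge i a with h | h
    · rw [hf i h, PowerSeries.coeff_coe, if_pos (by omega)]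
    · rw [PowerSeries.coeff_coe, if_neg (by omega), hU, PowerSeries.coeff_mk]
      congr 1
      omega
  have hUu : IsUnit U := by
    rw [PowerSeries.isUnit_iff_constantCoeff]
    simpa [hU, ← PowerSeries.coeff_zero_eq_constantCoeff_apply] using hu
  obtain ⟨V, hV⟩ := hUu.exists_right_inv
  refine ⟨HahnSeries.single (-a) 1 * HahnSeries.ofPowerSeries ℤ S V, ?_, ?_⟩
  · rw [hfU]
    calc _ = (HahnSeries.single a (1 : S) * HahnSeries.single (-a) 1)
          * (HahnSeries.ofPowerSeries ℤ S U * HahnSeries.ofPowerSeries ℤ S V) := by ring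
      _ = 1 := by
        rw [HahnSeries.single_mul_single, ← map_mul (HahnSeries.ofPowerSeries ℤ S), hV, map_one]
        simp
  · refine ((ordGe_single (-a) (1 : S)).mul (b := 0) fun i hi => ?_).mono (by omega)
    rw [PowerSeries.coeff_coe, if_pos hi]

end Basics

section FieldEmb

variable {K : Type*} [Field K]

theorem emb_eq_pemb : (emb : Polynomial K →+* LaurentSeries K) = pemb K := by
  apply Polynomial.ringHom_ext
  · intro a
    rw [pemb_C]
    simp only [emb, AlgHom.toRingHom_eq_coe, RingHom.coe_coe, Polynomial.aeval_C]
    rw [HahnSeries.algebraMap_apply', PowerSeries.algebraMap_apply]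
    simp
  · rw [pemb_X]
    simp [emb, Tvar]

end FieldEmb

section Smooth

variable {E E' : Type*} [AddCommGroup E] [AddCommGroup E']

/-- Functions on `ℕ` whose first `j` iterated differences are successively divisible by `p`. -/
def DiffDvd (p : ℕ) : ℕ → (ℕ → E) → Prop
  | 0, _ => True
  | j + 1, f => ∃ g, DiffDvd p j g ∧ ∀ z, f (z + 1) - f z = p • g z

/-- Functions on `ℕ` all of whose iterated differences are successively divisible by `p`. -/
def Smooth (p : ℕ) (f : ℕ → E) : Prop := ∀ j, DiffDvd p j f

variable {p : ℕ}

theorem DiffDvd.of_succ {j : ℕ} {f : ℕ → E} (h : DiffDvd p (j + 1) f) : DiffDvd p j f := by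
  induction j generalizing f with
  | zero => trivial
  | succ j ih =>
    obtain ⟨g, hg, h⟩ := h
    exact ⟨g, ih hg, h⟩

theorem DiffDvd.shift {j : ℕ} {f : ℕ → E} (h : DiffDvd p j f) :
    DiffDvd p j (fun z => f (z + 1)) := by
  induction j generalizing f with
  | zero => trivial
  | succ j ih =>
    obtain ⟨g, hg, h⟩ := h
    exact ⟨_, ih hg, fun z => h (z + 1)⟩

theorem DiffDvd.add {j : ℕ} {f g : ℕ → E} (hf : DiffDvd p j f) (hg : DiffDvd p j g) :
    DiffDvd p j (fun z => f z + g z) := by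
  induction j generalizing f g with
  | zero => trivial
  | succ j ih =>
    obtain ⟨f', hf', hf⟩ := hf
    obtain ⟨g', hg', hg⟩ := hg
    refine ⟨_, ih hf' hg', fun z => ?_⟩
    rw [smul_add, ← hf, ← hg]
    exact add_sub_add_comm _ _ _ _

theorem DiffDvd.map {j : ℕ} {f : ℕ → E} (hf : DiffDvd p j f) (φ : E →+ E') :
    DiffDvd p j (fun z => φ (f z)) := by
  induction j generalizing f with
  | zero => trivial
  | succ j ih =>
    obtain ⟨f', hf', hf⟩ := hf
    refine ⟨_, ih hf', fun z => ?_⟩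
    rw [← map_sub, hf, map_nsmul]

theorem DiffDvd.const {j : ℕ} (c : E) : DiffDvd p j (fun _ => c) := by
  induction j generalizing c with
  | zero => trivial
  | succ j ih => exact ⟨_, ih 0, fun z => by simp⟩

theorem Smooth.add {f g : ℕ → E} (hf : Smooth p f) (hg : Smooth p g) :
    Smooth p (fun z => f z + g z) := fun j => (hf j).add (hg j)

theorem Smooth.map {f : ℕ → E} (hf : Smooth p f) (φ : E →+ E') :
    Smooth p (fun z => φ (f z)) := fun j => (hf j).map φ

theorem smooth_const (c : E) : Smooth p (fun _ => c) := fun _ => DiffDvd.const c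

theorem Smooth.neg {f : ℕ → E} (hf : Smooth p f) : Smooth p (fun z => - f z) :=
  hf.map (-AddMonoidHom.id E)

theorem Smooth.sub {f g : ℕ → E} (hf : Smooth p f) (hg : Smooth p g) :
    Smooth p (fun z => f z - g z) := by
  simpa only [sub_eq_add_neg] using hf.add hg.neg

theorem Smooth.sum {ι : Type*} (s : Finset ι) {f : ι → ℕ → E} (hf : ∀ i ∈ s, Smooth p (f i)) :
    Smooth p (fun z => ∑ i ∈ s, f i z) := by
  classical
  induction s using Finset.induction_on with
  | empty => simpa using smooth_const (p := p) (0 : E)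
  | insert a s ha ih =>
    simp only [Finset.sum_insert ha]
    exact (hf a (by simp)).add (ih fun i hi => hf i (by simp [hi]))

end Smooth

section SmoothRing

variable {E : Type*} [Ring E] {p : ℕ}

theorem DiffDvd.mul {j : ℕ} {f g : ℕ → E} (hf : DiffDvd p j f) (hg : DiffDvd p j g) :
    DiffDvd p j (fun z => f z * g z) := by
  induction j generalizing f g with
  | zero => trivial
  | succ j ih =>
    have hf0 := hf.of_succ
    have hg0 := hg.of_succ
    obtain ⟨f', hf', hf⟩ := hf
    obtain ⟨g', hg', hg⟩ := hg
    refine ⟨_, (ih hf' hg0.shift).add (ih hf0 hg'), fun z => ?_⟩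
    rw [smul_add, ← smul_mul_assoc, ← mul_smul_comm, ← hf, ← hg]
    noncomm_ring

theorem Smooth.mul {f g : ℕ → E} (hf : Smooth p f) (hg : Smooth p g) :
    Smooth p (fun z => f z * g z) := fun j => (hf j).mul (hg j)

theorem smooth_pow {μ ν : E} (h : μ = 1 + p • ν) : Smooth p (fun z => μ ^ z) := by
  intro j
  induction j with
  | zero => trivial
  | succ j ih =>
    refine ⟨_, (DiffDvd.const ν).mul ih, fun z => ?_⟩
    have h' : p • ν = μ - 1 := by rw [h]; abel
    rw [← smul_mul_assoc, h']
    simp only [pow_succ']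
    noncomm_ring

theorem Smooth.inv {f g : ℕ → E} (hf : Smooth p f) (hfg : ∀ z, f z * g z = 1)
    (hgf : ∀ z, g z * f z = 1) : Smooth p g := by
  intro j
  induction j with
  | zero => trivial
  | succ j ih =>
    obtain ⟨f', hf', hf⟩ := hf (j + 1)
    refine ⟨_, ((DiffDvd.const (-1)).mul ih.shift).mul (hf'.mul ih), fun z => ?_⟩
    have : g (z + 1) - g z = (-1 * g (z + 1)) * ((f (z + 1) - f z) * g z) := by
      have h1 : (-1 * g (z + 1)) * ((f (z + 1) - f z) * g z)
        = g (z + 1) * (f z * g z) - (g (z + 1) * f (z + 1)) * g z := by noncomm_ring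
      rw [h1, hfg, hgf]; simp
    rw [this, hf, smul_mul_assoc, mul_smul_comm]

end SmoothRing

section SmoothComm

variable {E : Type*} [CommRing E] {p : ℕ}

theorem Smooth.prod {ι : Type*} (s : Finset ι) {f : ι → ℕ → E} (hf : ∀ i ∈ s, Smooth p (f i)) :
    Smooth p (fun z => ∏ i ∈ s, f i z) := by
  classical
  induction s using Finset.induction_on with
  | empty => simpa using smooth_const (p := p) (1 : E)
  | insert a s ha ih =>
    simp only [Finset.prod_insert ha]
    exact (hf a (by simp)).mul (ih fun i hi => hf i (by simp [hi]))

theorem Smooth.det {n : Type*} [Fintype n] [DecidableEq n] {M : ℕ → Matrix n n E}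
    (h : ∀ i j, Smooth p (fun z => M z i j)) : Smooth p (fun z => (M z).det) := by
  simp only [Matrix.det_apply']
  exact Smooth.sum _ fun σ _ => (smooth_const _).mul (Smooth.prod _ fun i _ => h _ _)

theorem DiffDvd.fwdDiff_iter {j : ℕ} {f : ℕ → E} (h : DiffDvd p j f) (z : ℕ) :
    ∃ c : E, (fwdDiff 1)^[j] f z = (p : E) ^ j * c := by
  induction j generalizing f with
  | zero => exact ⟨f z, by simp⟩
  | succ j ih =>
    obtain ⟨g, hg, h⟩ := h
    obtain ⟨c, hc⟩ := ih hg
    refine ⟨c, ?_⟩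
    have : fwdDiff 1 f = (p : E) • g := by
      funext z
      rw [fwdDiff, h]
      simp
    rw [Function.iterate_succ_apply, this, fwdDiff_iter_const_smul, Pi.smul_apply, hc, pow_succ',
      smul_eq_mul, mul_assoc]

end SmoothComm

section Hansel

variable {p : ℕ} [hp : Fact p.Prime]

theorem exists_factorial_mul_eq (hp2 : p ≠ 2) (j : ℕ) :
    ∃ u : ℤ_[p], (p : ℤ_[p]) ^ (j / 2) ∣ u ∧ u * (j.factorial : ℤ_[p]) = (p : ℤ_[p]) ^ j := by
  have hp3 : 3 ≤ p := by
    have := hp.out.two_le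
    omega
  obtain ⟨m, hm⟩ : p ^ padicValNat p j.factorial ∣ j.factorial := pow_padicValNat_dvd
  have hv : 2 * padicValNat p j.factorial ≤ j := by
    have h := sub_one_mul_padicValNat_factorial (p := p) j
    have h2 : 2 * padicValNat p j.factorial ≤ (p - 1) * padicValNat p j.factorial :=
      Nat.mul_le_mul_right _ (by omega)
    omega
  have hpm : ¬ p ∣ m := by
    intro hd
    refine pow_succ_padicValNat_not_dvd (p := p) (Nat.factorial_ne_zero j) ?_
    rw [pow_succ]
    conv_rhs => rw [hm]
    exact Nat.mul_dvd_mul_left _ hd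
  have hu : IsUnit (m : ℤ_[p]) := by
    rw [PadicInt.isUnit_iff, PadicInt.norm_natCast_eq_one_iff]
    exact (Nat.Prime.coprime_iff_not_dvd hp.out).2 hpm
  obtain ⟨w, hw⟩ := hu.exists_right_inv
  refine ⟨w * (p : ℤ_[p]) ^ (j - padicValNat p j.factorial), ?_, ?_⟩
  · exact Dvd.dvd.mul_left (pow_dvd_pow _ (by omega)) _
  · rw [hm]
    push_cast
    calc _ = (m * w) * ((p : ℤ_[p]) ^ (j - padicValNat p j.factorial)
              * (p : ℤ_[p]) ^ padicValNat p j.factorial) := by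
            rw [← hm]; ring
      _ = _ := by rw [hw, one_mul, ← pow_add]; congr 1; omega

open Polynomial in
theorem Smooth.exists_polynomial (hp2 : p ≠ 2) {k : ℕ} {f : ℕ → ZMod (p ^ k)}
    (hf : Smooth p f) : ∃ F : ℤ_[p][X], (∀ i, (p : ℤ_[p]) ^ (i / 2) ∣ F.coeff i) ∧
      ∀ z : ℕ, PadicInt.toZModPow k (F.eval (z : ℤ_[p])) = f z := by
  choose c hc using fun j => (hf j).fwdDiff_iter 0
  choose u hu hu' using exists_factorial_mul_eq (p := p) hp2
  choose C hC using fun j => (ZMod.ringHom_surjective (PadicInt.toZModPow (p := p) k)) (c j)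
  refine ⟨∑ j ∈ Finset.range k, Polynomial.C (C j * u j) * descPochhammer ℤ_[p] j, ?_, ?_⟩
  · intro i
    rw [Polynomial.finsetSum_coeff]
    refine Finset.dvd_sum fun j _ => ?_
    rw [Polynomial.coeff_C_mul]
    rcases lt_or_ge j i with h | h
    · rw [Polynomial.coeff_eq_zero_of_natDegree_lt, mul_zero]
      · exact dvd_zero _
      · rwa [descPochhammer_natDegree]
    · refine Dvd.dvd.mul_right (Dvd.dvd.mul_left ?_ _) _
      exact (pow_dvd_pow _ (Nat.div_le_div_right h)).trans (hu j)
  · intro z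
    have h1 : f z = ∑ j ∈ Finset.range (z + 1),
        z.choose j • ((p : ZMod (p ^ k)) ^ j * c j) := by
      have := shift_eq_sum_fwdDiff_iter 1 f z 0
      simp only [zero_add, smul_eq_mul, mul_one, hc] at this
      exact this
    have h2 : ∀ j, PadicInt.toZModPow k ((C j * u j) * (z.descFactorial j : ℤ_[p]))
        = z.choose j • ((p : ZMod (p ^ k)) ^ j * c j) := by
      intro j
      rw [Nat.descFactorial_eq_factorial_mul_choose]
      have : (C j * u j) * ((j.factorial * z.choose j : ℕ) : ℤ_[p])
          = z.choose j * ((u j * (j.factorial : ℤ_[p])) * C j) := by push_cast; ring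
      rw [this, hu']
      simp [hC, nsmul_eq_mul]
    rw [Polynomial.eval_finsetSum, map_sum, h1]
    simp only [Polynomial.eval_mul, Polynomial.eval_C, descPochhammer_eval_eq_descFactorial, h2]
    have hz : ∀ j, k ≤ j ∨ z < j → z.choose j • ((p : ZMod (p ^ k)) ^ j * c j) = 0 := by
      rintro j (h | h)
      · have : (p : ZMod (p ^ k)) ^ j = 0 := by
          rw [← Nat.cast_pow, ZMod.natCast_eq_zero_iff]
          exact pow_dvd_pow _ h
        simp [this]
      · simp [Nat.choose_eq_zero_of_lt h]
    rw [Finset.sum_subset (Finset.range_mono (le_max_left k (z + 1))) fun j _ hj =>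
        hz j (Or.inl (by simpa using hj)),
      ← Finset.sum_subset (Finset.range_mono (le_max_right k (z + 1))) fun j _ hj =>
        hz j (Or.inr (by simpa using hj))]

open Polynomial in
theorem pow_dvd_coeff_divByMonic {q : ℕ → ℤ_[p]} (hq : ∀ i j, i ≤ j → q i ∣ q j)
    (F : ℤ_[p][X]) (hF : ∀ i, q i ∣ F.coeff i) (z : ℤ_[p]) (i : ℕ) :
    q (i + 1) ∣ (F /ₘ (X - C z)).coeff i := by
  rw [Polynomial.coeff_divByMonic_X_sub_C]
  refine Finset.dvd_sum fun j hj => Dvd.dvd.mul_left ?_ _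
  rw [Finset.mem_Icc] at hj
  exact (hq _ _ hj.1).trans (hF j)

open Polynomial in
/-- A polynomial with rapidly decaying coefficients and many approximate integer roots is small
at `0`. -/
theorem exists_pow_dvd_eval_zero (s : Finset ℕ) : ∃ c : ℕ, ∀ (k t : ℕ) (F : ℤ_[p][X]),
    (∀ j, (p : ℤ_[p]) ^ ((j + t) / 2) ∣ F.coeff j) →
    (∀ z ∈ s, (p : ℤ_[p]) ^ k ∣ F.eval (z : ℤ_[p])) →
    (p : ℤ_[p]) ^ (min (k - c) ((s.card + t) / 2)) ∣ F.eval 0 := by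
  induction s using Finset.induction_on with
  | empty =>
    refine ⟨0, fun k t F hF _ => ?_⟩
    rw [← Polynomial.coeff_zero_eq_eval_zero]
    exact (pow_dvd_pow _ (by simp)).trans (hF 0)
  | insert z₀ s hz₀ ih =>
    obtain ⟨c, hc⟩ := ih
    obtain ⟨v, hv⟩ : ∃ v : ℕ, ∀ z ∈ s, ((z : ℤ_[p]) - z₀) ∣ (p : ℤ_[p]) ^ v := by
      have hz : ∀ z ∈ s, ∃ v : ℕ, ((z : ℤ_[p]) - z₀) ∣ (p : ℤ_[p]) ^ v := by
        intro z hz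
        have hne : (z : ℤ_[p]) - z₀ ≠ 0 := by
          rw [sub_ne_zero]
          intro h
          have : z = z₀ := by exact_mod_cast h
          exact hz₀ (this ▸ hz)
        have hu := PadicInt.unitCoeff_spec hne
        exact ⟨((z : ℤ_[p]) - z₀).valuation, by
          nth_rw 1 [hu]
          exact (Units.mul_left_dvd).2 dvd_rfl⟩
      choose! v hv using hz
      exact ⟨s.sup v, fun z hz => (hv z hz).trans (pow_dvd_pow _ (Finset.le_sup hz))⟩
    refine ⟨c + v, fun k t F hF hz => ?_⟩
    set G := F /ₘ (X - C (z₀ : ℤ_[p])) with hG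
    have hFG : C (F.eval (z₀ : ℤ_[p])) + (X - C (z₀ : ℤ_[p])) * G = F := by
      rw [← Polynomial.modByMonic_X_sub_C_eq_C_eval]
      exact Polynomial.modByMonic_add_div F _
    have hFev : ∀ x, F.eval x = F.eval (z₀ : ℤ_[p]) + (x - z₀) * G.eval x := by
      intro x
      conv_lhs => rw [← hFG]
      simp
    have h := hc (k - v) (t + 1) G (fun j => ?_) (fun z hzs => ?_)
    · rw [hFev]
      refine dvd_add ((pow_dvd_pow _ ?_).trans (hz z₀ (by simp)))
        (Dvd.dvd.mul_left ((pow_dvd_pow _ ?_).trans h) _)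
      · omega
      · rw [Finset.card_insert_of_notMem hz₀]
        have : s.card + 1 + t = s.card + (t + 1) := by omega
        rw [this]
        omega
    · have := pow_dvd_coeff_divByMonic (q := fun j => (p : ℤ_[p]) ^ ((j + t) / 2))
        (fun i j hij => pow_dvd_pow _ (by omega)) F hF z₀ j
      rwa [show j + (t + 1) = j + 1 + t by omega]
    · rcases le_or_gt k v with hkv | hkv
      · simp [Nat.sub_eq_zero_of_le hkv]
      have h1 : (p : ℤ_[p]) ^ k ∣ ((z : ℤ_[p]) - z₀) * G.eval (z : ℤ_[p]) := by
        have h2 := hFev z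
        rw [← sub_eq_iff_eq_add'] at h2
        rw [← h2]
        exact dvd_sub (hz z (by simp [hzs])) (hz z₀ (by simp))
      have h2 : (p : ℤ_[p]) ^ k ∣ (p : ℤ_[p]) ^ v * G.eval (z : ℤ_[p]) :=
        h1.trans (mul_dvd_mul_right (hv z hzs) _)
      rw [show k = v + (k - v) by omega, pow_add] at h2
      exact (mul_dvd_mul_iff_left (pow_ne_zero _ (by exact_mod_cast hp.out.ne_zero))).1 h2

/-- A `p`-adic integer that is, modulo every power of `p`, the value at `0` of a smooth function
vanishing on a fixed infinite set, is zero. -/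
theorem eq_zero_of_smooth (hp2 : p ≠ 2) {h : ℤ_[p]} {Z : Set ℕ} (hZ : Z.Infinite)
    (H : ∀ k, ∃ f : ℕ → ZMod (p ^ k), Smooth p f ∧ f 0 = PadicInt.toZModPow k h ∧
      ∀ z ∈ Z, f z = 0) : h = 0 := by
  rw [← PadicInt.ext_of_toZModPow]
  intro N
  rw [map_zero, ← RingHom.mem_ker, PadicInt.ker_toZModPow, Ideal.mem_span_singleton]
  obtain ⟨s, hsZ, hs⟩ := hZ.exists_subset_card_eq (2 * N)
  obtain ⟨c, hc⟩ := exists_pow_dvd_eval_zero (p := p) s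
  obtain ⟨f, hf, hf0, hfZ⟩ := H (c + N)
  obtain ⟨F, hF, hFf⟩ := hf.exists_polynomial hp2
  have h1 := hc (c + N) 0 F hF fun z hz => by
    rw [← Ideal.mem_span_singleton, ← PadicInt.ker_toZModPow, RingHom.mem_ker, hFf]
    exact hfZ z (hsZ hz)
  have h2 : (p : ℤ_[p]) ^ (c + N) ∣ h - F.eval 0 := by
    rw [← Ideal.mem_span_singleton, ← PadicInt.ker_toZModPow, RingHom.mem_ker, map_sub, ← hf0,
      ← hFf]
    simp
  have h3 : (p : ℤ_[p]) ^ N ∣ F.eval 0 := by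
    refine (pow_dvd_pow _ ?_).trans h1
    omega
  simpa using dvd_add ((pow_dvd_pow _ (by omega)).trans h2) h3

end Hansel

section Interpolation

variable {S : Type*} [CommRing S]

/-- The `n × n` Hankel matrix of `γ`. -/
def hankel (γ : LaurentSeries S) (n : ℕ) : Matrix (Fin n) (Fin n) S :=
  fun i j => γ.coeff ((i : ℤ) + j + 1)

theorem coeff_single_one_mul (f : LaurentSeries S) (j i : ℤ) :
    (HahnSeries.single (-j) (1 : S) * f).coeff i = f.coeff (i + j) := by
  rw [HahnSeries.coeff_single_mul, one_mul, sub_neg_eq_add]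

theorem IsPoly.eq_sum {Y : LaurentSeries S} (hY : IsPoly Y) {n : ℕ} (hn : OrdGe (1 - n) Y) :
    Y = ∑ j : Fin n, Y.coeff (-(j : ℤ)) • HahnSeries.single (-(j : ℤ)) (1 : S) := by
  ext i
  rw [HahnSeries.coeff_sum]
  simp only [HahnSeries.coeff_smul, smul_eq_mul]
  rcases lt_or_ge 0 i with hi | hi
  · rw [hY i hi, Finset.sum_eq_zero]
    intro j _
    rw [HahnSeries.coeff_single_of_ne (by omega), mul_zero]
  · obtain ⟨k, rfl⟩ : ∃ k : ℕ, i = -(k : ℤ) := ⟨i.natAbs, by omega⟩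
    rcases lt_or_ge k n with hk | hk
    · rw [Finset.sum_eq_single (⟨k, hk⟩ : Fin n)]
      · simp
      · intro j _ hj
        rw [HahnSeries.coeff_single_of_ne, mul_zero]
        intro h
        exact hj (Fin.ext (show (j : ℕ) = k by omega))
      · simp
    · rw [hn _ (by omega), Finset.sum_eq_zero]
      intro j _
      rw [HahnSeries.coeff_single_of_ne (by omega), mul_zero]

theorem hankel_mulVec (γ : LaurentSeries S) {n : ℕ} (y : Fin n → S) (i : Fin n) :
    (hankel γ n).mulVec y i
      = ((∑ j : Fin n, y j • HahnSeries.single (-(j : ℤ)) (1 : S)) * γ).coeff (i + 1) := by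
  rw [Finset.sum_mul, HahnSeries.coeff_sum, Matrix.mulVec, dotProduct]
  refine Finset.sum_congr rfl fun j _ => ?_
  rw [← HahnSeries.C_mul_eq_smul, mul_assoc, HahnSeries.C_mul_eq_smul, HahnSeries.coeff_smul,
    coeff_single_one_mul, hankel, smul_eq_mul, mul_comm]
  congr 2
  omega

theorem det_eq_zero_of_mulVec {n : Type*} [Fintype n] [DecidableEq n] {M : Matrix n n S}
    {y : n → S} (h : M.mulVec y = 0) {j : n} (hj : IsUnit (y j)) : M.det = 0 := by
  have h1 : (M.adjugate * M).mulVec y = 0 := by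
    rw [← Matrix.mulVec_mulVec, h, Matrix.mulVec_zero]
  rw [Matrix.adjugate_mul, Matrix.smul_mulVec, Matrix.one_mulVec] at h1
  have h2 := congrFun h1 j
  simp only [Pi.smul_apply, smul_eq_mul, Pi.zero_apply] at h2
  exact (hj.mul_left_eq_zero).1 h2

theorem isUnit_one_add_nsmul {E : Type*} [Ring E] [Module S E] [IsScalarTower S E E]
    [SMulCommClass S E E] {p : ℕ} (hp : IsNilpotent (p : S)) (V : E) :
    IsUnit (1 + p • V) := by
  refine IsNilpotent.isUnit_one_add ?_
  obtain ⟨k, hk⟩ := hp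
  refine ⟨k, ?_⟩
  rw [← Nat.cast_smul_eq_nsmul S, smul_pow, hk, zero_smul]

/-- Reduction step: `X ± Yγ` times powers of the conjugate units. -/
theorem exists_mul_pow_eq {γ E x y M X Y : LaurentSeries S} (hγ : γ ^ 2 = E) (hE : IsPoly E)
    (hx : IsPoly x) (hy : IsPoly y) (hM : IsPoly M) (hX : IsPoly X) (hY : IsPoly Y) (z : ℕ) :
    ∃ P Q : LaurentSeries S, IsPoly P ∧ IsPoly Q ∧
      P + Q * γ = (X + Y * γ) * ((x - y * γ) * M) ^ z ∧
      P - Q * γ = (X - Y * γ) * ((x + y * γ) * M) ^ z := by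
  induction z with
  | zero => exact ⟨X, Y, hX, hY, by simp, by simp⟩
  | succ z ih =>
    obtain ⟨P, Q, hP, hQ, h1, h2⟩ := ih
    refine ⟨(P * x - Q * y * E) * M, (Q * x - P * y) * M,
      ((hP.mul hx).sub ((hQ.mul hy).mul hE)).mul hM, ((hQ.mul hx).sub (hP.mul hy)).mul hM, ?_, ?_⟩
    · rw [pow_succ, ← mul_assoc, ← h1, ← hγ]
      ring
    · rw [pow_succ, ← mul_assoc, ← h2, ← hγ]
      ring

/-- The interpolation theorem: along an arithmetic progression of step `m`, the vanishing of
Hankel determinants is detected by a smooth function. -/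
theorem exists_smooth_interpolation {p : ℕ} [Nontrivial S] (hp : IsNilpotent (p : S))
    (hloc : ∀ r : S, IsUnit r ∨ (p : S) ∣ r) (h2 : IsUnit (2 : S))
    {γ E x y ν : LaurentSeries S} {e m a : ℕ}
    (hγo : OrdGe (-(e : ℤ)) γ) (hγu : IsUnit (γ.coeff (-(e : ℤ)))) (hγ : γ ^ 2 = E)
    (hE : IsPoly E) (hx : IsPoly x) (hy : IsPoly y) (hN : x ^ 2 - E * y ^ 2 = 1 + p • ν)
    (hso : OrdGe (-(m : ℤ)) (x + y * γ)) (hsu : IsUnit ((x + y * γ).coeff (-(m : ℤ)))) :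
    ∃ f : ℕ → S, Smooth p f ∧ f 0 = (hankel γ a).det ∧
      ∀ z, (∃ X Y : LaurentSeries S, IsPoly X ∧ IsPoly Y ∧ OrdGe (1 - (m * z + a : ℕ)) Y ∧
        (∃ i, IsUnit (Y.coeff i)) ∧ OrdGe ((m * z + a : ℕ) + 1) (X - Y * γ)) → f z = 0 := by
  obtain ⟨γ', hγγ', hγ'o⟩ := exists_inv_of_isUnit hγo hγu
  obtain ⟨v, hv, hvo⟩ := exists_inv_of_isUnit hso hsu
  rw [neg_neg] at hγ'o hvo
  obtain ⟨h, hh⟩ := h2.exists_right_inv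
  set N := x ^ 2 - E * y ^ 2 with hNdef
  have hNpoly : IsPoly N := by
    rw [hNdef, pow_two, pow_two]
    exact (hx.mul hx).sub (hE.mul (hy.mul hy))
  obtain ⟨M, hMpoly, hNM⟩ : ∃ M, IsPoly M ∧ N * M = 1 := by
    have hn : IsNilpotent (⟨N - 1, hNpoly.sub isPoly_one⟩ : polySubring S) := by
      obtain ⟨k, hk⟩ := hp
      have h1 : N - 1 = p • ν := by rw [hN]; ring
      have h2 : (N - 1) ^ k = 0 := by
        rw [h1, nsmul_eq_mul, mul_pow, ← map_natCast (HahnSeries.C (Γ := ℤ) (R := S)) p,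
          ← map_pow, hk, map_zero, zero_mul]
      exact ⟨k, Subtype.ext h2⟩
    obtain ⟨⟨M, hM⟩, hM'⟩ := hn.isUnit_one_add.exists_right_inv
    refine ⟨M, hM, ?_⟩
    have := congrArg Subtype.val hM'
    simpa using this
  have hNxy : (x + y * γ) * (x - y * γ) = N := by rw [hNdef, ← hγ]; ring
  have hb : (x - y * γ) * M = v := by
    calc (x - y * γ) * M = ((x + y * γ) * v) * ((x - y * γ) * M) := by rw [hv, one_mul]
      _ = ((x + y * γ) * (x - y * γ) * M) * v := by ring
      _ = v := by rw [hNxy, hNM, one_mul]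
  -- the operators
  set π : Module.End S (LaurentSeries S) := trunc 0 with hπ
  set πa : Module.End S (LaurentSeries S) := trunc (-(a : ℤ)) with hπa
  set mγ : Module.End S (LaurentSeries S) := mulL γ with hmγ
  set mγ' : Module.End S (LaurentSeries S) := mulL γ' with hmγ'
  set κ : Module.End S (LaurentSeries S) := (1 - π) * mγ * ((-h) • (πa * mγ')) with hκ
  set μ : Module.End S (LaurentSeries S) := mulL N with hμ
  have hμν : μ = 1 + p • mulL ν := by
    refine LinearMap.ext fun f => ?_
    simp [hμ, hN, add_mul, mul_assoc]
  have hμpow : ∀ (z : ℕ) (f : LaurentSeries S), (μ ^ z) f = N ^ z * f := by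
    intro z f
    induction z with
    | zero => simp
    | succ z ih => rw [pow_succ', Module.End.mul_apply, ih, hμ, mulL_apply, pow_succ']; ring
  have hππ : π * π = π := LinearMap.ext fun f => trunc_zero_trunc f
  have hπκ : π * κ = 0 := by
    have : π * (1 - π) = 0 := by rw [mul_sub, mul_one, hππ, sub_self]
    rw [hκ, ← mul_assoc, ← mul_assoc, this, zero_mul, zero_mul]
  have hsm : Smooth p (fun z => μ ^ z) := smooth_pow hμν
  set A : ℕ → Module.End S (LaurentSeries S) :=
    fun z => 1 + π * (μ ^ z - 1) * (1 - κ) * π with hA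
  have hAs : Smooth p A := (smooth_const _).add
    ((((smooth_const _).mul (hsm.sub (smooth_const _))).mul (smooth_const _)).mul (smooth_const _))
  have hAu : ∀ z, IsUnit (A z) := by
    intro z
    have h1 : μ ^ z - 1 = p • ((∑ i ∈ Finset.range z, μ ^ i) * mulL ν) := by
      rw [← geom_sum_mul, hμν, add_sub_cancel_left, mul_smul_comm]
    have : A z = 1 + p • (π * ((∑ i ∈ Finset.range z, μ ^ i) * mulL ν) * (1 - κ) * π) := by
      simp only [hA]
      rw [h1, mul_smul_comm, smul_mul_assoc, smul_mul_assoc]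
    rw [this]
    exact isUnit_one_add_nsmul (S := S) hp _
  choose B hAB hBA using fun z => isUnit_iff_exists.1 (hAu z)
  have hBs : Smooth p B := hAs.inv hAB hBA
  set Ξ : ℕ → Module.End S (LaurentSeries S) :=
    fun z => μ ^ z - μ ^ z * (1 - κ) * B z * π * μ ^ z with hΞ
  have hΞs : Smooth p Ξ := hsm.sub
    ((((hsm.mul (smooth_const _)).mul hBs).mul (smooth_const _)).mul hsm)
  set s : ℕ → LaurentSeries S :=
    fun j => (1 - π) (HahnSeries.single (-(j : ℤ)) (1 : S) * γ) with hs
  set Mz : ℕ → Matrix (Fin a) (Fin a) S :=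
    fun z i j => (Ξ z (s j)).coeff ((i : ℤ) + 1) with hMz
  refine ⟨fun z => (Mz z).det, Smooth.det fun i j => ?_, ?_, ?_⟩
  · exact hΞs.map (AddMonoidHom.mk' (fun Θ : Module.End S (LaurentSeries S) =>
      (Θ (s j)).coeff ((i : ℤ) + 1)) fun Θ Θ' => by simp)
  · suffices h : Mz 0 = hankel γ a by rw [← h]
    funext i j
    have hB0 : B 0 = 1 := by
      have := hAB 0
      simpa [hA] using this
    have hπs : π (s j) = 0 := by
      simp only [hs]
      rw [← Module.End.mul_apply, mul_sub, mul_one, hππ, sub_self, LinearMap.zero_apply]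
    have : Ξ 0 (s j) = s j := by
      simp [hΞ, hB0, hπs]
    simp only [hMz, this, hankel]
    simp only [hs]
    rw [LinearMap.sub_apply, Module.End.one_apply, HahnSeries.coeff_sub, hπ, coeff_trunc,
      if_neg (by omega), sub_zero, coeff_single_one_mul]
    congr 1
    omega
  · rintro z ⟨X, Y, hX, hY, hYo, ⟨i₀, hi₀⟩, hXY⟩
    obtain ⟨P, Q, hP, hQ, hPQ1, hPQ2⟩ := exists_mul_pow_eq hγ hE hx hy hMpoly hX hY z
    set n := m * z + a with hn
    have hplus : OrdGe (1 - e - a) (P + Q * γ) := by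
      rw [hPQ1, hb]
      have h1 : OrdGe (1 - n - e : ℤ) (X + Y * γ) := by
        have : X + Y * γ = (X - Y * γ) + (Y * γ + Y * γ) := by ring
        rw [this]
        have h3 : OrdGe (1 - n - e : ℤ) (Y * γ) := (hYo.mul hγo).mono (by omega)
        exact (hXY.mono (by omega)).add (h3.add h3)
      refine (h1.mul (hvo.pow z)).mono ?_
      rw [hn]; push_cast; nlinarith
    have hminus : OrdGe (a + 1) (N ^ z * (P - Q * γ)) := by
      have : N ^ z * (P - Q * γ) = (X - Y * γ) * (x + y * γ) ^ z := by
        rw [hPQ2]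
        calc _ = (X - Y * γ) * (x + y * γ) ^ z * (N * M) ^ z := by
              rw [mul_pow, mul_pow]; ring
          _ = _ := by rw [hNM, one_pow, mul_one]
      rw [this]
      refine (hXY.mul (hso.pow z)).mono ?_
      rw [hn]; push_cast; nlinarith
    set ω := P - Q * γ with hω
    set g := π ω with hg
    set Q1 := πa Q with hQ1
    set Q0 := Q - Q1 with hQ0
    have hQ0poly : IsPoly Q0 := by
      refine hQ.sub fun i hi => ?_
      rw [hQ1, hπa, coeff_trunc, if_neg (by omega)]
    have hQ0o : OrdGe (1 - a) Q0 := (ordGe_sub_trunc _ Q).mono (by omega)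
    have hC2 : ∀ f : LaurentSeries S, (-h) • (f + f) = - f := fun f => by
      rw [← two_smul S f, smul_smul, neg_mul, mul_comm h, hh, neg_one_smul]
    have hQ1g : Q1 = (-h) • πa (γ' * g) := by
      have h1 : Q + Q = γ' * (P + Q * γ) - γ' * ω := by
        have : γ' * (P + Q * γ) - γ' * ω = (γ * γ') * (Q + Q) := by rw [hω]; ring
        rw [this, hγγ', one_mul]
      have h2 : πa (γ' * (P + Q * γ)) = 0 :=
        trunc_of_ordGe ((hγ'o.mul hplus).mono (by omega))
      have h3 : πa (γ' * ω) = πa (γ' * g) := by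
        rw [← sub_eq_zero, ← map_sub, ← mul_sub]
        exact trunc_of_ordGe ((hγ'o.mul (ordGe_sub_trunc 0 ω)).mono (by omega))
      have h4 : Q1 + Q1 = - πa (γ' * g) := by
        rw [hQ1, ← map_add, h1, map_sub, h2, h3, zero_sub]
      rw [← neg_neg (πa (γ' * g)), ← h4, smul_neg, hC2, neg_neg]
    set s' := (1 - π) (Q0 * γ) with hs'
    have hκg : κ g = (1 - π) (Q1 * γ) := by
      rw [hQ1g, mul_comm]
      rfl
    have hωg : ω = (1 - κ) g - s' := by
      have h1 : (1 - π) ω = - ((1 - π) (Q1 * γ) + (1 - π) (Q0 * γ)) := by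
        have h2 : (1 - π) P = 0 := by
          rw [LinearMap.sub_apply, Module.End.one_apply, hπ, hP.trunc_eq, sub_self]
        rw [← map_add, ← add_mul, hQ0, add_sub_cancel, hω, map_sub, h2, zero_sub]
      have h2 : ω = g + (1 - π) ω := by
        rw [LinearMap.sub_apply, Module.End.one_apply, hg, add_sub_cancel]
      rw [LinearMap.sub_apply, Module.End.one_apply, hκg, hs', sub_sub]
      rw [h1, ← sub_eq_add_neg] at h2
      exact h2
    have hR : OrdGe (a + 1) ((μ ^ z) ω) := by rw [hμpow]; exact hminus
    have hπR : π ((μ ^ z) ω) = 0 := trunc_of_ordGe (hR.mono (by omega))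
    have hπg : π g = g := trunc_zero_trunc ω
    have hAg : A z g = π ((μ ^ z) s') := by
      have h1 : π ((μ ^ z) ((1 - κ) g)) = π ((μ ^ z) s') := by
        rw [hωg, map_sub, map_sub, sub_eq_zero] at hπR
        exact hπR
      have h2 : π ((1 - κ) g) = g := by
        rw [LinearMap.sub_apply, Module.End.one_apply, map_sub, hπg, ← Module.End.mul_apply π κ,
          hπκ, LinearMap.zero_apply, sub_zero]
      have h3 : A z g = g + (π ((μ ^ z) ((1 - κ) (π g))) - π ((1 - κ) (π g))) := by
        rw [← map_sub]
        rfl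
      rw [h3, hπg, h1, h2, add_sub_cancel]
    have hgB : g = B z (π ((μ ^ z) s')) := by
      rw [← hAg, ← Module.End.mul_apply, hBA, Module.End.one_apply]
    have hΞs' : Ξ z s' = - (μ ^ z) ω := by
      have : Ξ z s' = (μ ^ z) s' - (μ ^ z) ((1 - κ) (B z (π ((μ ^ z) s')))) := rfl
      rw [this, ← hgB, hωg, map_sub]
      abel
    set y' : Fin a → S := fun j => Q.coeff (-(j : ℤ)) with hy'
    have hQ0c : ∀ j : Fin a, Q0.coeff (-(j : ℤ)) = y' j := fun j => by
      rw [hQ0, HahnSeries.coeff_sub, hQ1, hπa, coeff_trunc, if_neg (by omega), sub_zero]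
    have hQ0sum : Q0 = ∑ j : Fin a, y' j • HahnSeries.single (-(j : ℤ)) (1 : S) := by
      rw [hQ0poly.eq_sum hQ0o]
      simp only [hQ0c]
    have hs'sum : s' = ∑ j : Fin a, y' j • s j := by
      rw [hs', hQ0sum, Finset.sum_mul, map_sum]
      refine Finset.sum_congr rfl fun j _ => ?_
      rw [← HahnSeries.C_mul_eq_smul, mul_assoc, HahnSeries.C_mul_eq_smul, map_smul]
    have hker : (Mz z).mulVec y' = 0 := by
      funext i
      have h1 : (Ξ z s').coeff ((i : ℤ) + 1) = 0 := by
        rw [hΞs', HahnSeries.coeff_neg, hR _ (by omega), neg_zero]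
      rw [hs'sum, map_sum, HahnSeries.coeff_sum] at h1
      rw [Matrix.mulVec, dotProduct, Pi.zero_apply, ← h1]
      refine Finset.sum_congr rfl fun j _ => ?_
      rw [map_smul, HahnSeries.coeff_smul, smul_eq_mul, mul_comm]
    by_contra hdet
    have hdvd : ∀ j, (p : S) ∣ y' j := fun j =>
      (hloc (y' j)).resolve_left fun hu => hdet (det_eq_zero_of_mulVec hker hu)
    have dQ0 : PDvd (p : S) Q0 := by
      rw [hQ0sum]
      intro i
      rw [HahnSeries.coeff_sum]
      exact Finset.dvd_sum fun j _ => Dvd.dvd.mul_right (hdvd j) _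
    have ds : PDvd (p : S) s' := by
      rw [hs', mul_comm]
      exact (dQ0.mul γ).map (1 - π)
    have dg : PDvd (p : S) g := by
      rw [hgB]
      exact ((ds.map (μ ^ z)).map π).map (B z)
    have dω : PDvd (p : S) ω := by
      rw [hωg]
      exact (dg.map _).sub ds
    have dQ1 : PDvd (p : S) Q1 := by
      rw [hQ1g]
      exact (dg.mul γ').map ((-h) • πa)
    have dQ : PDvd (p : S) Q := by
      have := dQ0.add dQ1
      rwa [hQ0, sub_add_cancel] at this
    have dplus : PDvd (p : S) (P + Q * γ) := by
      have : P + Q * γ = ω + (γ * Q + γ * Q) := by rw [hω]; ring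
      rw [this]
      exact dω.add ((dQ.mul γ).add (dQ.mul γ))
    have d1 : PDvd (p : S) (X + Y * γ) := by
      have : X + Y * γ = (x + y * γ) ^ z * (P + Q * γ) := by
        rw [hPQ1]
        calc _ = (X + Y * γ) * ((x + y * γ) * (x - y * γ) * M) ^ z := by
              rw [hNxy, hNM, one_pow, mul_one]
          _ = _ := by rw [mul_assoc, mul_pow]; ring
      rw [this]
      exact dplus.mul _
    have d2 : PDvd (p : S) (X - Y * γ) := by
      have : X - Y * γ = (x - y * γ) ^ z * ω := by
        rw [hPQ2]
        calc _ = (X - Y * γ) * ((x + y * γ) * (x - y * γ) * M) ^ z := by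
              rw [hNxy, hNM, one_pow, mul_one]
          _ = _ := by rw [mul_comm (x + y * γ), mul_assoc, mul_pow]; ring
      rw [this]
      exact dω.mul _
    have d3 : PDvd (p : S) (Y + Y) := by
      have : Y + Y = γ' * ((X + Y * γ) - (X - Y * γ)) := by
        calc Y + Y = (Y + Y) * (γ * γ') := by rw [hγγ', mul_one]
          _ = _ := by ring
      rw [this]
      exact (d1.sub d2).mul _
    have d4 := d3 i₀
    rw [HahnSeries.coeff_add, ← two_mul] at d4
    have hpu : IsUnit (p : S) := isUnit_of_dvd_unit d4 (h2.mul hi₀)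
    obtain ⟨k, hk⟩ := hp
    exact not_isUnit_zero (hk ▸ hpu.pow k)

end Interpolation

section Bad

variable {R : Type*} [CommRing R]

/-- `γ` has an approximation which is too good in degree `n`; over a domain this means that the
`n`-th Hankel determinant of `γ` vanishes. -/
def Bad (γ : LaurentSeries R) (n : ℕ) : Prop :=
  ∃ X Y : LaurentSeries R, IsPoly X ∧ IsPoly Y ∧ Y ≠ 0 ∧ OrdGe (1 - n) Y ∧
    OrdGe (n + 1) (X - Y * γ)

theorem bad_of_det_eq_zero [IsDomain R] {γ : LaurentSeries R} {n : ℕ}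
    (h : (hankel γ n).det = 0) : Bad γ n := by
  obtain ⟨y, hy0, hy⟩ := Matrix.exists_mulVec_eq_zero_iff.2 h
  set Y : LaurentSeries R := ∑ j : Fin n, y j • HahnSeries.single (-(j : ℤ)) (1 : R) with hY
  have hYp : IsPoly Y := (polySubring R).sum_mem fun j _ => by
    rw [← HahnSeries.C_mul_eq_smul]
    exact (isPoly_C _).mul (single_isPoly (by omega) 1)
  have hYo : OrdGe (1 - n) Y := OrdGe.sum _ _ fun j _ i hi => by
    rw [HahnSeries.coeff_smul, ordGe_single _ _ _ (by omega), smul_zero]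
  refine ⟨trunc 0 (Y * γ), Y, isPoly_trunc _, hYp, ?_, hYo, ?_⟩
  · intro h0
    apply hy0
    funext j
    have : Y.coeff (-(j : ℤ)) = y j := by
      rw [hY, HahnSeries.coeff_sum, Finset.sum_eq_single j]
      · simp
      · intro i _ hij
        rw [HahnSeries.coeff_smul, HahnSeries.coeff_single_of_ne, smul_zero]
        intro h
        exact hij (Fin.ext (by omega))
      · simp
    rw [← this, h0]
    simp
  · intro i hi
    rw [HahnSeries.coeff_sub, coeff_trunc]
    split_ifs with h0
    · exact sub_self _
    · rw [zero_sub, neg_eq_zero]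
      obtain ⟨k, hk⟩ : ∃ k : Fin n, i = (k : ℤ) + 1 := ⟨⟨(i - 1).toNat, by omega⟩, by simp; omega⟩
      have := congrFun hy k
      rw [hankel_mulVec] at this
      rw [hk]
      exact this

end Bad

section Padic

variable {p : ℕ} [hp : Fact p.Prime]

/-- A nonzero polynomial over `ℤ_p` is a scalar multiple of one with a unit coefficient. -/
theorem exists_primitive {Y : LaurentSeries ℤ_[p]} (hY : IsPoly Y) (h0 : Y ≠ 0) {n : ℕ}
    (hn : OrdGe (1 - n) Y) : ∃ (c : ℤ_[p]) (Y' : LaurentSeries ℤ_[p]), c ≠ 0 ∧ Y = c • Y' ∧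
      IsPoly Y' ∧ OrdGe (1 - n) Y' ∧ ∃ i, IsUnit (Y'.coeff i) := by
  have hne : ∃ i, Y.coeff i ≠ 0 := by
    by_contra! h
    exact h0 (HahnSeries.ext (funext h))
  set V : Set ℕ := {v | ∃ i, Y.coeff i ≠ 0 ∧ (Y.coeff i).valuation = v} with hV
  have hVne : V.Nonempty := by
    obtain ⟨i, hi⟩ := hne
    exact ⟨_, i, hi, rfl⟩
  obtain ⟨i₀, hi₀, hv₀⟩ := Nat.sInf_mem hVne
  have hdvd : ∀ i, Y.coeff i₀ ∣ Y.coeff i := by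
    intro i
    by_cases hi : Y.coeff i = 0
    · rw [hi]; exact dvd_zero _
    have hle : (Y.coeff i₀).valuation ≤ (Y.coeff i).valuation := by
      rw [hv₀]
      exact Nat.sInf_le ⟨i, hi, rfl⟩
    rw [PadicInt.unitCoeff_spec hi₀, PadicInt.unitCoeff_spec hi]
    exact (Units.mul_left_dvd).2 (Dvd.dvd.mul_left (pow_dvd_pow _ hle) _)
  obtain ⟨Y', hY'⟩ := pdvd_iff.1 (show PDvd (Y.coeff i₀) Y from hdvd)
  have hc : ∀ i, Y.coeff i = 0 → Y'.coeff i = 0 := fun i hi => by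
    rw [hY', HahnSeries.coeff_smul, smul_eq_mul] at hi
    exact (mul_eq_zero.1 hi).resolve_left hi₀
  refine ⟨Y.coeff i₀, Y', hi₀, hY', fun i hi => hc i (hY i hi), fun i hi => hc i (hn i hi),
    i₀, ?_⟩
  have h1 : Y.coeff i₀ = Y.coeff i₀ * Y'.coeff i₀ := by
    conv_lhs => rw [hY']
    rw [HahnSeries.coeff_smul, smul_eq_mul]
  have : Y'.coeff i₀ = 1 := mul_left_cancel₀ hi₀ (by rw [← h1, mul_one])
  rw [this]
  exact isUnit_one

theorem Bad.exists_primitive {γ : LaurentSeries ℤ_[p]} {n : ℕ} (h : Bad γ n) :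
    ∃ X Y : LaurentSeries ℤ_[p], IsPoly X ∧ IsPoly Y ∧ OrdGe (1 - n) Y ∧
      (∃ i, IsUnit (Y.coeff i)) ∧ OrdGe (n + 1) (X - Y * γ) := by
  obtain ⟨X, Y, hX, hY, hY0, hYo, hXY⟩ := h
  obtain ⟨c, Y', hc, hYY', hY', hYo', hu⟩ := LaurentCF.exists_primitive hY hY0 hYo
  refine ⟨trunc 0 (Y' * γ), Y', isPoly_trunc _, hY', hYo', hu, ?_⟩
  have hYγ : Y * γ = c • (Y' * γ) := by
    rw [hYY', ← HahnSeries.C_mul_eq_smul, mul_assoc, HahnSeries.C_mul_eq_smul]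
  have hX' : X = c • trunc 0 (Y' * γ) := by
    rw [← map_smul, ← hYγ, ← sub_eq_zero]
    refine IsPoly.eq_zero (hX.sub (isPoly_trunc _)) ?_
    have : X - trunc 0 (Y * γ) = (X - Y * γ) + (Y * γ - trunc 0 (Y * γ)) := by ring
    rw [this]
    exact (hXY.mono (by omega)).add (ordGe_sub_trunc 0 _)
  intro i hi
  have := hXY i hi
  rw [hX', hYγ, ← smul_sub, HahnSeries.coeff_smul, smul_eq_mul] at this
  exact (mul_eq_zero.1 this).resolve_left hc

theorem isUnit_or_dvd_zmod (k : ℕ) (r : ZMod (p ^ k)) :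
    IsUnit r ∨ ((p : ℕ) : ZMod (p ^ k)) ∣ r := by
  obtain ⟨x, rfl⟩ := ZMod.ringHom_surjective (PadicInt.toZModPow (p := p) k) r
  by_cases hx : IsUnit x
  · exact Or.inl (hx.map _)
  · right
    have : (p : ℤ_[p]) ∣ x := by
      rw [← PadicInt.norm_lt_one_iff_dvd]
      rw [PadicInt.isUnit_iff] at hx
      exact lt_of_le_of_ne (PadicInt.norm_le_one x) hx
    simpa using map_dvd (PadicInt.toZModPow (p := p) k) this

theorem isUnit_two (hp2 : p ≠ 2) : IsUnit (2 : ℤ_[p]) := by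
  have : IsUnit ((2 : ℕ) : ℤ_[p]) := by
    rw [PadicInt.isUnit_iff, PadicInt.norm_natCast_eq_one_iff]
    exact (Nat.coprime_primes hp.out Nat.prime_two).2 hp2
  exact_mod_cast this

/-- If `γ` is a quadratic irrational over `ℤ_p[T]` with a unit modulo `p` of degree `m`, and `γ`
has no bad approximation in degrees less than `m`, then it has only finitely many. -/
theorem finite_bad (hp2 : p ≠ 2) {γ E x y : LaurentSeries ℤ_[p]} {e m : ℕ} (hm : 0 < m)
    (hγo : OrdGe (-(e : ℤ)) γ) (hγu : IsUnit (γ.coeff (-(e : ℤ)))) (hγ : γ ^ 2 = E)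
    (hE : IsPoly E) (hx : IsPoly x) (hy : IsPoly y)
    (hN : PDvd (p : ℤ_[p]) (x ^ 2 - E * y ^ 2 - 1))
    (hso : OrdGe (-(m : ℤ)) (x + y * γ)) (hsu : IsUnit ((x + y * γ).coeff (-(m : ℤ))))
    (hgood : ∀ a < m, ¬ Bad γ a) : {n | Bad γ n}.Finite := by
  by_contra hinf
  have hinf : {n | Bad γ n}.Infinite := hinf
  obtain ⟨a, ha, hZ⟩ : ∃ a < m, {z | Bad γ (m * z + a)}.Infinite := by
    by_contra! hfin
    refine hinf ?_
    have hsub : {n | Bad γ n} ⊆ ⋃ a ∈ Finset.range m,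
        (fun z => m * z + a) '' {z | Bad γ (m * z + a)} := by
      intro n hn
      simp only [Set.mem_iUnion, Finset.mem_range]
      refine ⟨n % m, Nat.mod_lt _ hm, n / m, ?_, ?_⟩
      · change Bad γ (m * (n / m) + n % m)
        rw [Nat.div_add_mod]
        exact hn
      · exact Nat.div_add_mod n m
    refine Set.Finite.subset (Set.Finite.biUnion (Finset.finite_toSet _) fun a ha => ?_) hsub
    exact Set.Finite.image _ (hfin a (by simpa using ha))
  refine hgood a ha (bad_of_det_eq_zero (eq_zero_of_smooth hp2 hZ fun k => ?_))
  rcases Nat.eq_zero_or_pos k with rfl | hk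
  · have : Subsingleton (ZMod (p ^ 0)) := by
      rw [pow_zero]; infer_instance
    exact ⟨0, smooth_const 0, Subsingleton.elim _ _, fun _ _ => rfl⟩
  have : Fact (1 < p ^ k) := ⟨Nat.one_lt_pow hk.ne' hp.out.one_lt⟩
  set φ := PadicInt.toZModPow (p := p) k with hφ
  have hpk : IsNilpotent ((p : ℕ) : ZMod (p ^ k)) := ⟨k, by
    rw [← Nat.cast_pow, ZMod.natCast_self]⟩
  obtain ⟨ν, hν⟩ := pdvd_iff.1 hN
  have h2 : IsUnit (2 : ZMod (p ^ k)) := by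
    have := (isUnit_two hp2).map φ
    rwa [map_ofNat] at this
  obtain ⟨f, hf, hf0, hfz⟩ := exists_smooth_interpolation (S := ZMod (p ^ k)) (p := p)
    (γ := mapL φ γ) (E := mapL φ E) (x := mapL φ x) (y := mapL φ y) (ν := mapL φ ν)
    (e := e) (m := m) (a := a) hpk (isUnit_or_dvd_zmod k) h2 (hγo.mapL φ)
    (by rw [coeff_mapL]; exact hγu.map φ) (by rw [← map_pow, hγ]) (hE.mapL φ) (hx.mapL φ)
    (hy.mapL φ) (by
      rw [← map_pow, ← map_pow, ← map_mul, ← map_sub, sub_eq_iff_eq_add'.1 hν, map_add, map_one,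
        ← map_nsmul, Nat.cast_smul_eq_nsmul])
    (by rw [← map_mul, ← map_add]; exact hso.mapL φ)
    (by rw [← map_mul, ← map_add, coeff_mapL]; exact hsu.map φ)
  refine ⟨f, hf, ?_, fun z hz => hfz z ?_⟩
  · rw [hf0, RingHom.map_det]
    congr 1
  · obtain ⟨X, Y, hX, hY, hYo, ⟨i, hi⟩, hXY⟩ := Bad.exists_primitive hz
    refine ⟨mapL φ X, mapL φ Y, hX.mapL φ, hY.mapL φ, hYo.mapL φ, ⟨i, ?_⟩, ?_⟩
    · rw [coeff_mapL]; exact hi.map φ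
    · rw [← map_mul, ← map_sub]; exact hXY.mapL φ

end Padic

section Field

variable {F : Type*} [Field F]

/-- A rational function whose square is a polynomial is a polynomial. -/
theorem isPoly_of_mul_eq {Γ X Y : LaurentSeries F} (hΓ : IsPoly (Γ ^ 2)) (hX : IsPoly X)
    (hY : IsPoly Y) (hY0 : Y ≠ 0) (h : Y * Γ = X) : IsPoly Γ := by
  obtain ⟨E, hE⟩ := hΓ.exists_pemb
  obtain ⟨x, rfl⟩ := hX.exists_pemb
  obtain ⟨y, rfl⟩ := hY.exists_pemb
  have h1 : y ^ 2 ∣ x ^ 2 := by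
    refine ⟨E, pemb_injective ?_⟩
    rw [map_mul, map_pow, map_pow, ← h, ← hE]
    ring
  obtain ⟨w, rfl⟩ := (IsIntegrallyClosed.pow_dvd_pow_iff two_ne_zero).1 h1
  rw [map_mul] at h
  rw [mul_left_cancel₀ hY0 h]
  exact isPoly_pemb w

theorem OrdGe.le_order {f : LaurentSeries F} (hf : f ≠ 0) {a : ℤ} (h : OrdGe a f) :
    a ≤ f.order := by
  by_contra hlt
  exact HahnSeries.coeff_order_eq_zero.not.2 hf (h _ (by omega))

theorem ordGe_of_le_order {f : LaurentSeries F} {a : ℤ} (h : a ≤ f.order) : OrdGe a f :=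
  ordGe_order.mono h

theorem IsPoly.order_le {f : LaurentSeries F} (hf : IsPoly f) (h0 : f ≠ 0) : f.order ≤ 0 := by
  by_contra hlt
  exact HahnSeries.coeff_order_eq_zero.not.2 h0 (hf _ (by omega))

theorem order_eq_of_coeff {f : LaurentSeries F} {a : ℤ} (h : OrdGe a f) (h0 : f.coeff a ≠ 0) :
    f.order = a := by
  have hf : f ≠ 0 := by rintro rfl; simp at h0
  exact le_antisymm (HahnSeries.order_le_of_coeff_ne_zero h0) (h.le_order hf)

/-- Dirichlet's approximation theorem. -/
theorem exists_approx (Γ : LaurentSeries F) (n : ℕ) : ∃ X Y : Polynomial F, Y ≠ 0 ∧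
    Y.natDegree ≤ n ∧ OrdGe (n + 1) (pemb F X - pemb F Y * Γ) := by
  let ψ : (Fin (n + 1) → F) →ₗ[F] (Fin n → F) :=
    Matrix.mulVecLin fun i j => Γ.coeff ((i : ℤ) + j + 1)
  have hker : LinearMap.ker ψ ≠ ⊥ := LinearMap.ker_ne_bot_of_finrank_lt (by simp)
  obtain ⟨y, hy, hy0⟩ := (Submodule.ne_bot_iff _).1 hker
  set Y : Polynomial F := ∑ j : Fin (n + 1), Polynomial.monomial j (y j) with hY
  have hYc : ∀ j : Fin (n + 1), Y.coeff j = y j := by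
    intro j
    rw [hY, Polynomial.finsetSum_coeff, Finset.sum_eq_single j]
    · simp
    · intro i _ hij
      rw [Polynomial.coeff_monomial, if_neg]
      intro h
      exact hij (Fin.ext h)
    · simp
  obtain ⟨X, hX⟩ := (isPoly_trunc (pemb F Y * Γ)).exists_pemb
  refine ⟨X, Y, ?_, ?_, ?_⟩
  · intro h
    apply hy0
    funext j
    rw [← hYc, h]
    simp
  · exact Polynomial.natDegree_sum_le_of_forall_le _ _ fun j _ =>
      (Polynomial.natDegree_monomial_le _).trans (by omega)
  · intro i hi
    rw [← hX, HahnSeries.coeff_sub, coeff_trunc]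
    split_ifs with h0
    · exact sub_self _
    · rw [zero_sub, neg_eq_zero]
      obtain ⟨k, hk⟩ : ∃ k : Fin n, i = (k : ℤ) + 1 := ⟨⟨(i - 1).toNat, by omega⟩, by simp; omega⟩
      have h1 := congrFun (LinearMap.mem_ker.1 hy) k
      rw [hY, map_sum, Finset.sum_mul, HahnSeries.coeff_sum, hk]
      refine Eq.trans ?_ h1
      simp only [ψ]
      refine Finset.sum_congr rfl fun j _ => ?_
      rw [pemb_monomial, HahnSeries.coeff_single_mul, mul_comm]
      congr 2
      omega

theorem order_mul_of_ne {f g : LaurentSeries F} (hf : f ≠ 0) (hg : g ≠ 0) :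
    (f * g).order = f.order + g.order := HahnSeries.order_mul hf hg

/-- The polynomial Pell equation over a finite field has a nontrivial solution. -/
theorem exists_pell [Finite F] {Γ : LaurentSeries F} {e : ℕ} (hΓo : OrdGe (-(e : ℤ)) Γ)
    (hΓ2 : IsPoly (Γ ^ 2)) (hΓ : ¬ IsPoly Γ) :
    ∃ x y : LaurentSeries F, IsPoly x ∧ IsPoly y ∧ y ≠ 0 ∧ x ^ 2 - Γ ^ 2 * y ^ 2 = 1 := by
  choose X Y hY0 hYd hXY using exists_approx Γ
  obtain ⟨E, hE⟩ := hΓ2.exists_pemb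
  set N : ℕ → Polynomial F := fun n => X n ^ 2 - E * Y n ^ 2 with hN
  have hNe : ∀ n, pemb F (N n)
      = (pemb F (X n) - pemb F (Y n) * Γ) * (pemb F (X n) + pemb F (Y n) * Γ) := by
    intro n
    simp only [hN, map_sub, map_mul, map_pow, ← hE]
    ring
  have hne : ∀ n, pemb F (X n) - pemb F (Y n) * Γ ≠ 0 := fun n h =>
    hΓ (isPoly_of_mul_eq hΓ2 (isPoly_pemb (X n)) (isPoly_pemb (Y n))
      (by rw [Ne, map_eq_zero_iff _ pemb_injective]; exact hY0 n) (sub_eq_zero.1 h).symm)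
  have hne' : ∀ n, pemb F (X n) + pemb F (Y n) * Γ ≠ 0 := fun n h =>
    hΓ (isPoly_of_mul_eq hΓ2 (isPoly_pemb (-X n)) (isPoly_pemb (Y n))
      (by rw [Ne, map_eq_zero_iff _ pemb_injective]; exact hY0 n)
      (by rw [map_neg]; exact (neg_eq_of_add_eq_zero_right h).symm))
  have hN0 : ∀ n, N n ≠ 0 := fun n h => by
    have := hNe n
    rw [h, map_zero] at this
    exact mul_ne_zero (hne n) (hne' n) this.symm
  have hNd : ∀ n i, e ≤ i → (N n).coeff i = 0 := by
    intro n i hi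
    have h1 : OrdGe (-(n + e) : ℤ) (pemb F (Y n) * Γ) :=
      ((ordGe_pemb _ (hYd n)).mul hΓo).mono (by omega)
    have h2 : OrdGe (-(n + e) : ℤ) (pemb F (X n) + pemb F (Y n) * Γ) := by
      have : pemb F (X n) + pemb F (Y n) * Γ
        = (pemb F (X n) - pemb F (Y n) * Γ) + (pemb F (Y n) * Γ + pemb F (Y n) * Γ) := by ring
      rw [this]
      exact ((hXY n).mono (by omega)).add (h1.add h1)
    rw [← coeff_pemb, hNe]
    exact ((hXY n).mul h2) _ (by omega)
  have hmod : ∀ n (P : Polynomial F) i, e ≤ i → (P % N n).coeff i = 0 := by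
    intro n P i hi
    refine Polynomial.coeff_eq_zero_of_degree_lt ((Polynomial.degree_mod_lt P (hN0 n)).trans_le ?_)
    rw [Polynomial.degree_le_iff_coeff_zero]
    intro j hj
    exact hNd n j (hi.trans (by exact_mod_cast hj.le))
  let Φ : ℕ → (Fin e → F) × (Fin e → F) × (Fin e → F) := fun n =>
    (fun i => (N n).coeff i, fun i => (X n % N n).coeff i, fun i => (Y n % N n).coeff i)
  have hΦ : ∀ n n', Φ n = Φ n' → N n = N n' ∧ X n % N n = X n' % N n' ∧
      Y n % N n = Y n' % N n' := by
    intro n n' h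
    simp only [Φ, Prod.mk.injEq] at h
    have key : ∀ P Q : Polynomial F, (∀ i, e ≤ i → P.coeff i = 0) → (∀ i, e ≤ i → Q.coeff i = 0) →
        ((fun i : Fin e => P.coeff i) = fun i : Fin e => Q.coeff i) → P = Q := by
      intro P Q hP hQ h
      ext i
      rcases lt_or_ge i e with hi | hi
      · exact congrFun h ⟨i, hi⟩
      · rw [hP i hi, hQ i hi]
    exact ⟨key _ _ (hNd n) (hNd n') h.1, key _ _ (hmod n _) (hmod n' _) h.2.1,
      key _ _ (hmod n _) (hmod n' _) h.2.2⟩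
  obtain ⟨c, hc⟩ := Finite.exists_infinite_fiber Φ
  have hc : (Φ ⁻¹' {c}).Infinite := Set.infinite_coe_iff.1 hc
  obtain ⟨n, hn⟩ := hc.nonempty
  obtain ⟨n', hn', hlt⟩ := hc.exists_gt
    (pemb F (X n) - pemb F (Y n) * Γ).order.toNat
  obtain ⟨h1, h2, h3⟩ := hΦ n n' (by rw [Set.mem_preimage.1 hn, Set.mem_preimage.1 hn'])
  rw [← h1] at h2 h3
  obtain ⟨u, hu⟩ : N n ∣ X n' - X n := EuclideanDomain.mod_eq_zero.1 (by
    rw [Polynomial.sub_mod, h2, sub_self])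
  obtain ⟨w, hw⟩ : N n ∣ Y n' - Y n := EuclideanDomain.mod_eq_zero.1 (by
    rw [Polynomial.sub_mod, h3, sub_self])
  have hX' : X n' = X n + N n * u := by rw [← hu]; ring
  have hY' : Y n' = Y n + N n * w := by rw [← hw]; ring
  set x := 1 + u * X n - E * w * Y n with hx
  set y := w * X n - u * Y n with hy
  have hxX : X n' = x * X n + E * y * Y n := by
    rw [hX', hx, hy]; simp only [hN]; ring
  have hyY : Y n' = x * Y n + y * X n := by
    rw [hY', hx, hy]; simp only [hN]; ring
  have hpell : x ^ 2 - E * y ^ 2 = 1 := by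
    have : (x ^ 2 - E * y ^ 2) * N n = 1 * N n := by
      rw [one_mul]
      conv_rhs => rw [h1]
      simp only [hN]
      rw [hxX, hyY]
      ring
    exact mul_right_cancel₀ (hN0 n) this
  refine ⟨pemb F x, pemb F y, isPoly_pemb x, isPoly_pemb y, ?_, ?_⟩
  · rw [Ne, map_eq_zero_iff _ pemb_injective]
    intro hy0
    rw [hy0] at hxX hyY hpell
    have hx2 : x * x = 1 := by linear_combination hpell
    have h4 : pemb F (X n) - pemb F (Y n) * Γ
        = pemb F x * (pemb F (X n') - pemb F (Y n') * Γ) := by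
      rw [hxX, hyY]
      simp only [map_mul, mul_zero, zero_mul, add_zero]
      have := congrArg (pemb F) hx2
      rw [map_mul, map_one] at this
      linear_combination (-(pemb F (X n)) + pemb F (Y n) * Γ) * this
    have hxd : x.natDegree ≤ 0 :=
      (Polynomial.natDegree_eq_zero_of_isUnit (IsUnit.of_mul_eq_one x hx2)).le
    have h5 : OrdGe (n' + 1) (pemb F (X n) - pemb F (Y n) * Γ) := by
      rw [h4]
      exact ((ordGe_pemb x hxd).mul (hXY n')).mono (by omega)
    have := h5.le_order (hne n)
    omega
  · rw [hE, ← map_pow, ← map_pow, ← map_mul, ← map_sub, hpell, map_one]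

/-- Normalisation of the solution of the Pell equation. -/
theorem exists_pell_deg [Finite F] (h2 : (2 : F) ≠ 0) {Γ : LaurentSeries F} {e : ℕ} (he : 0 < e)
    (hΓo : OrdGe (-(e : ℤ)) Γ) (hΓ1 : Γ.coeff (-(e : ℤ)) ≠ 0)
    (hΓ2 : IsPoly (Γ ^ 2)) (hΓ : ¬ IsPoly Γ) :
    ∃ (m : ℕ) (x y : LaurentSeries F), 0 < m ∧ IsPoly x ∧ IsPoly y ∧ x ^ 2 - Γ ^ 2 * y ^ 2 = 1 ∧
      OrdGe (-(m : ℤ)) x ∧ OrdGe (e - m) y ∧ (x + y * Γ).coeff (-(m : ℤ)) ≠ 0 := by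
  have hΓord : Γ.order = -(e : ℤ) := order_eq_of_coeff hΓo hΓ1
  have hΓ0 : Γ ≠ 0 := by rintro rfl; simp at hΓ1
  have h2' : (2 : LaurentSeries F) ≠ 0 := by
    have : (2 : LaurentSeries F) = HahnSeries.C (2 : F) := by rw [map_ofNat]
    rw [this]
    exact (map_ne_zero_iff _ HahnSeries.C_injective).2 h2
  have half : ∀ {a : ℤ} {f : LaurentSeries F}, OrdGe a (2 * f) → OrdGe a f := by
    intro a f h i hi
    have := h i hi
    rw [two_mul, HahnSeries.coeff_add, ← two_mul] at this
    exact (mul_eq_zero.1 this).resolve_left h2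
  have key : ∀ x y : LaurentSeries F, IsPoly x → IsPoly y → x ^ 2 - Γ ^ 2 * y ^ 2 = 1 →
      (x + y * Γ).order < 0 → ∃ (m : ℕ) (x y : LaurentSeries F), 0 < m ∧ IsPoly x ∧ IsPoly y ∧
      x ^ 2 - Γ ^ 2 * y ^ 2 = 1 ∧
      OrdGe (-(m : ℤ)) x ∧ OrdGe (e - m) y ∧ (x + y * Γ).coeff (-(m : ℤ)) ≠ 0 := by
    intro x y hx hy h hlt
    have hmul : (x + y * Γ) * (x - y * Γ) = 1 := by linear_combination h
    have hs0 : x + y * Γ ≠ 0 := left_ne_zero_of_mul_eq_one hmul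
    have hs0' : x - y * Γ ≠ 0 := right_ne_zero_of_mul_eq_one hmul
    have hord := order_mul_of_ne hs0 hs0'
    rw [hmul, HahnSeries.order_one] at hord
    obtain ⟨m, hm⟩ : ∃ m : ℕ, (x + y * Γ).order = -(m : ℤ) :=
      ⟨(-(x + y * Γ).order).toNat, by omega⟩
    have h1 : OrdGe (-(m : ℤ)) (x + y * Γ) := ordGe_of_le_order hm.ge
    have h3 : OrdGe (-(m : ℤ)) (x - y * Γ) := ordGe_of_le_order (by omega)
    refine ⟨m, x, y, by omega, hx, hy, h, ?_, ?_, ?_⟩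
    · refine half ?_
      have : 2 * x = (x + y * Γ) + (x - y * Γ) := by ring
      rw [this]
      exact h1.add h3
    · have h4 : OrdGe (-(m : ℤ)) (y * Γ) := by
        refine half ?_
        have : 2 * (y * Γ) = (x + y * Γ) - (x - y * Γ) := by ring
        rw [this]
        exact h1.sub h3
      by_cases hy0 : y = 0
      · rw [hy0]; exact ordGe_zero _
      · have h5 := h4.le_order (mul_ne_zero hy0 hΓ0)
        rw [order_mul_of_ne hy0 hΓ0, hΓord] at h5
        exact ordGe_of_le_order (by omega)
    · rw [← hm]
      exact HahnSeries.coeff_order_eq_zero.not.2 hs0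
  obtain ⟨x, y, hx, hy, hy0, h⟩ := exists_pell hΓo hΓ2 hΓ
  have hmul : (x + y * Γ) * (x - y * Γ) = 1 := by linear_combination h
  have hs0 : x + y * Γ ≠ 0 := left_ne_zero_of_mul_eq_one hmul
  have hs0' : x - y * Γ ≠ 0 := right_ne_zero_of_mul_eq_one hmul
  have hord := order_mul_of_ne hs0 hs0'
  rw [hmul, HahnSeries.order_one] at hord
  rcases lt_trichotomy (x + y * Γ).order 0 with hlt | heq | hgt
  · exact key x y hx hy h hlt
  · exfalso
    have h4 : OrdGe 0 (y * Γ) := by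
      refine half ?_
      have : 2 * (y * Γ) = (x + y * Γ) - (x - y * Γ) := by ring
      rw [this]
      exact (ordGe_of_le_order heq.ge).sub (ordGe_of_le_order (by omega))
    have h5 := h4.le_order (mul_ne_zero hy0 hΓ0)
    rw [order_mul_of_ne hy0 hΓ0, hΓord] at h5
    have := hy.order_le hy0
    omega
  · refine key x (-y) hx hy.neg (by rw [neg_sq]; exact h) ?_
    rw [neg_mul, ← sub_eq_add_neg]
    omega

end Field

section Lift

variable {p : ℕ} [hp : Fact p.Prime]

/-- Coefficientwise lift of a series modulo `p`, keeping the vanishing coefficients. -/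
theorem exists_lift (f : LaurentSeries (ZMod p)) : ∃ g : LaurentSeries ℤ_[p],
    mapL PadicInt.toZMod g = f ∧ ∀ i, f.coeff i = 0 → g.coeff i = 0 := by
  choose s hs using ZMod.ringHom_surjective (PadicInt.toZMod (p := p))
  classical
  let s' : ZeroHom (ZMod p) ℤ_[p] := ⟨fun r => if r = 0 then 0 else s r, by simp⟩
  refine ⟨HahnSeries.map f s', ?_, ?_⟩
  · ext i
    rw [coeff_mapL, HahnSeries.map_coeff]
    by_cases h : f.coeff i = 0
    · rw [h, map_zero, map_zero]
    · simp [s', h, hs]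
  · intro i h
    rw [HahnSeries.map_coeff, h, map_zero]

/-- The number `m` below depends only on `γ` modulo `p`. -/
theorem exists_threshold (hp2 : p ≠ 2) {Γ : LaurentSeries (ZMod p)} {e : ℕ} (he : 0 < e)
    (hΓo : OrdGe (-(e : ℤ)) Γ) (hΓ1 : Γ.coeff (-(e : ℤ)) ≠ 0)
    (hΓ2 : IsPoly (Γ ^ 2)) (hΓ : ¬ IsPoly Γ) : ∃ m : ℕ, ∀ γ : LaurentSeries ℤ_[p],
      mapL PadicInt.toZMod γ = Γ → OrdGe (-(e : ℤ)) γ → IsPoly (γ ^ 2) →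
      (∀ a < m, ¬ Bad γ a) → {n | Bad γ n}.Finite := by
  have h2 : (2 : ZMod p) ≠ 0 := by
    have := (isUnit_two hp2).map (PadicInt.toZMod (p := p))
    rw [map_ofNat] at this
    exact this.ne_zero
  obtain ⟨m, x, y, hm, hx, hy, hpell, hxo, hyo, hc⟩ := exists_pell_deg h2 he hΓo hΓ1 hΓ2 hΓ
  obtain ⟨x', hxx', hx'⟩ := exists_lift x
  obtain ⟨y', hyy', hy'⟩ := exists_lift y
  refine ⟨m, fun γ hγΓ hγo hγ2 hgood => ?_⟩
  have hunit : ∀ r : ℤ_[p], PadicInt.toZMod r ≠ 0 → IsUnit r := by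
    intro r hr
    by_contra h
    apply hr
    rw [← RingHom.mem_ker, PadicInt.ker_toZMod]
    exact (IsLocalRing.mem_maximalIdeal r).2 h
  refine finite_bad hp2 (e := e) hm hγo (hunit _ ?_) rfl hγ2 (x := x') (y := y')
    (fun i hi => hx' i (hx i hi)) (fun i hi => hy' i (hy i hi)) ?_ ?_ (hunit _ ?_) hgood
  · rw [← coeff_mapL, hγΓ]
    exact hΓ1
  · intro i
    rw [← Ideal.mem_span_singleton, ← PadicInt.maximalIdeal_eq_span_p, ← PadicInt.ker_toZMod,
      RingHom.mem_ker, ← coeff_mapL]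
    simp only [map_sub, map_mul, map_pow, map_one, hγΓ, hxx', hyy', hpell, sub_self,
      HahnSeries.coeff_zero]
  · have hxo' : OrdGe (-(m : ℤ)) x' := fun i hi => hx' i (hxo i hi)
    have hyo' : OrdGe (e - m : ℤ) y' := fun i hi => hy' i (hyo i hi)
    exact hxo'.add ((hyo'.mul hγo).mono (by omega))
  · rw [← coeff_mapL]
    simp only [map_add, map_mul, hγΓ, hxx', hyy']
    exact hc

end Lift

section Embedding

open Polynomial in
/-- A nonconstant integer polynomial has roots modulo arbitrarily large primes. -/
theorem exists_prime_dvd_eval {f : ℤ[X]} (hf : 0 < f.natDegree) (N : ℕ) :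
    ∃ p : ℕ, p.Prime ∧ N < p ∧ ∃ n : ℤ, (p : ℤ) ∣ f.eval n := by
  by_cases hc : f.coeff 0 = 0
  · obtain ⟨p, hNp, hp⟩ := Nat.exists_infinite_primes (N + 1)
    exact ⟨p, hp, hNp, 0, by rw [← coeff_zero_eq_eval_zero, hc]; exact dvd_zero _⟩
  set c := f.coeff 0 with hcdef
  obtain ⟨g, hg⟩ : (X : ℤ[X]) ∣ f - C c := by
    rw [X_dvd_iff]
    simp [hcdef]
  have hfeval : ∀ n, f.eval n = c + n * g.eval n := fun n => by
    have := congrArg (eval n) hg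
    simp only [eval_sub, eval_C, eval_mul, eval_X] at this
    linarith
  have hfin : {n : ℤ | (f.eval n) ^ 2 = c ^ 2}.Finite := by
    have h0 : f ^ 2 - C (c ^ 2) ≠ 0 := by
      intro h
      have h1 : f ^ 2 = C (c ^ 2) := sub_eq_zero.1 h
      have := congrArg natDegree h1
      rw [natDegree_pow, natDegree_C] at this
      omega
    refine ((f ^ 2 - C (c ^ 2)).rootSet_finite ℤ).subset fun n hn => ?_
    rw [mem_rootSet]
    refine ⟨h0, ?_⟩
    have hn' : (f.eval n) ^ 2 = c ^ 2 := hn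
    simp [hn']
  have hM : (N.factorial : ℤ) ≠ 0 := by exact_mod_cast N.factorial_ne_zero
  obtain ⟨k, hk⟩ : ∃ k : ℤ, (f.eval (c * N.factorial * k)) ^ 2 ≠ c ^ 2 := by
    by_contra! h
    refine Set.infinite_range_of_injective (f := fun k : ℤ => c * N.factorial * k)
      (mul_right_injective₀ (mul_ne_zero hc hM)) (hfin.subset ?_)
    rintro _ ⟨k, rfl⟩
    exact h k
  set v : ℤ := 1 + N.factorial * (k * g.eval (c * N.factorial * k)) with hv
  have hfv : f.eval (c * N.factorial * k) = c * v := by rw [hfeval, hv]; ring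
  have hv1 : v.natAbs ≠ 1 := by
    intro h
    apply hk
    rw [hfv, mul_pow, ← Int.natAbs_sq v, h]
    simp
  obtain ⟨p, hp, hpv⟩ := Nat.exists_prime_and_dvd hv1
  have hpv' : (p : ℤ) ∣ v := Int.natCast_dvd.2 hpv
  refine ⟨p, hp, ?_, _, hfv ▸ hpv'.mul_left c⟩
  by_contra! hle
  have h1 : (p : ℤ) ∣ (N.factorial : ℤ) := by
    exact_mod_cast Nat.dvd_factorial hp.pos hle
  have h2 : (p : ℤ) ∣ 1 := by
    have := dvd_sub hpv' (h1.mul_right (k * g.eval (c * N.factorial * k)))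
    rwa [hv, add_sub_cancel_right] at this
  have h3 : (p : ℕ) ∣ 1 := by exact_mod_cast h2
  exact hp.one_lt.ne' (Nat.dvd_one.1 h3)

theorem norm_le_one_of_isIntegral {p : ℕ} [Fact p.Prime] {x : ℚ_[p]} (hx : IsIntegral ℤ x) :
    ‖x‖ ≤ 1 := by
  obtain ⟨y, rfl⟩ := IsIntegrallyClosed.isIntegral_iff.1 (hx.tower_top (A := ℤ_[p]))
  exact y.norm_le_one

open Polynomial in
/-- A number field embeds in some `ℚ_p` with `p` odd in such a way that finitely many given
elements become integral. -/
theorem exists_padic_embedding {K : Type*} [Field K] [NumberField K] (s : Finset K) :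
    ∃ (p : ℕ) (_ : Fact p.Prime), p ≠ 2 ∧ ∃ ι : K →+* ℚ_[p], ∀ x ∈ s, ‖ι x‖ ≤ 1 := by
  obtain ⟨m, hm, hms⟩ := exists_integral_multiples ℤ ℚ s
  set pb := Field.powerBasisOfFiniteOfSeparable ℚ K
  set f₀ := minpoly ℚ pb.gen with hf₀
  have hirr : Irreducible f₀ := minpoly.irreducible pb.isIntegral_gen
  obtain ⟨u₀, v₀, huv⟩ := hirr.separable
  obtain ⟨b, hb0, hb⟩ := IsLocalization.integerNormalization_spec (nonZeroDivisors ℤ) f₀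
  obtain ⟨b₁, hb₁0, hb₁⟩ := IsLocalization.integerNormalization_spec (nonZeroDivisors ℤ) u₀
  obtain ⟨b₂, hb₂0, hb₂⟩ := IsLocalization.integerNormalization_spec (nonZeroDivisors ℤ) v₀
  set f := IsLocalization.integerNormalization (nonZeroDivisors ℤ) f₀
  set u := IsLocalization.integerNormalization (nonZeroDivisors ℤ) u₀
  set v := IsLocalization.integerNormalization (nonZeroDivisors ℤ) v₀
  have hb0 : b ≠ 0 := nonZeroDivisors.ne_zero hb0
  have hb10 : b₁ ≠ 0 := nonZeroDivisors.ne_zero hb₁0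
  have hb20 : b₂ ≠ 0 := nonZeroDivisors.ne_zero hb₂0
  have hinj : Function.Injective (algebraMap ℤ ℚ) := (algebraMap ℤ ℚ).injective_int
  have hbez : C (b₂ : ℤ) * u * f + C (b₁ : ℤ) * v * derivative f = C ((b : ℤ) * b₁ * b₂) := by
    apply map_injective _ hinj
    have e : ∀ (z : ℤ) (q : ℚ[X]), z • q = C (algebraMap ℤ ℚ z) * q := fun z q => by
      rw [zsmul_eq_mul]; simp
    simp only [Polynomial.map_add, Polynomial.map_mul, map_C, ← derivative_map, hb, hb₁, hb₂,
      e, map_mul, derivative_mul, derivative_C]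
    linear_combination C (algebraMap ℤ ℚ b) * C (algebraMap ℤ ℚ b₁) *
      C (algebraMap ℤ ℚ b₂) * huv
  have hfdeg : 0 < f.natDegree := by
    have h1 : (f.map (algebraMap ℤ ℚ)).natDegree = f.natDegree := natDegree_map_eq_of_injective hinj _
    have h2 : (f.map (algebraMap ℤ ℚ)) = C (b : ℚ) * f₀ := by
      rw [hb, zsmul_eq_mul]; simp
    rw [← h1, h2, natDegree_C_mul (by exact_mod_cast hb0)]
    exact hirr.natDegree_pos
  obtain ⟨p, hp, hpN, n, hn⟩ := exists_prime_dvd_eval hfdeg (2 + (m * (b * b₁ * b₂)).natAbs)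
  have : Fact p.Prime := ⟨hp⟩
  have hpm : ¬ (p : ℤ) ∣ m * (b * b₁ * b₂) := by
    intro h
    have := Nat.le_of_dvd (Int.natAbs_pos.2 (by simp [hm, hb0, hb10, hb20])) (Int.natCast_dvd.1 h)
    omega
  have hder : ‖(derivative f).aeval (n : ℤ_[p])‖ = 1 := by
    have e : (derivative f).aeval (n : ℤ_[p]) = (((derivative f).eval n : ℤ) : ℤ_[p]) := by
      simpa using aeval_algebraMap_apply ℤ_[p] n (derivative f)
    rw [e]
    refine le_antisymm (PadicInt.norm_le_one _) (not_lt.1 fun hlt => hpm ?_)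
    rw [PadicInt.norm_int_lt_one_iff_dvd] at hlt
    have := congrArg (eval n) hbez
    simp only [eval_add, eval_mul, eval_C] at this
    rw [← this]
    exact ((hn.mul_left _).add (hlt.mul_left _)).mul_left _
  have hval : ‖f.aeval (n : ℤ_[p])‖ < 1 := by
    have e : f.aeval (n : ℤ_[p]) = ((f.eval n : ℤ) : ℤ_[p]) := by
      simpa using aeval_algebraMap_apply ℤ_[p] n f
    rw [e, PadicInt.norm_int_lt_one_iff_dvd]
    exact hn
  obtain ⟨z, hz, -⟩ := hensels_lemma (F := f) (a := (n : ℤ_[p])) (by rw [hder]; simpa using hval)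
  have hroot : aeval (z : ℚ_[p]) f₀ = 0 := by
    have h1 : aeval (z : ℚ_[p]) f = 0 := by
      have := aeval_algebraMap_apply ℚ_[p] z f
      rw [hz, map_zero] at this
      exact this
    have h2 : aeval (z : ℚ_[p]) (f.map (algebraMap ℤ ℚ)) = 0 := by
      rw [aeval_map_algebraMap, h1]
    rw [hb, zsmul_eq_mul, map_mul] at h2
    refine (mul_eq_zero.1 h2).resolve_left ?_
    rw [map_intCast]
    exact_mod_cast hb0
  refine ⟨p, this, by omega, (pb.lift _ hroot).toRingHom, fun x hx => ?_⟩
  have h1 : ‖(pb.lift _ hroot) (m • x)‖ ≤ 1 :=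
    norm_le_one_of_isIntegral ((hms x hx).map ((pb.lift _ hroot).restrictScalars ℤ))
  rw [map_zsmul, zsmul_eq_mul, norm_mul] at h1
  have h2 : ‖(m : ℚ_[p])‖ = 1 := by
    refine le_antisymm (Padic.norm_int_le_one _) (not_lt.1 fun hlt => hpm ?_)
    exact (Padic.norm_intCast_lt_one_iff.1 hlt).mul_right _
  rwa [h2, one_mul] at h1

end Embedding

section Hankel

variable {R : Type*} [CommRing R]

theorem det_eq_zero_of_bad [IsDomain R] {γ : LaurentSeries R} {n : ℕ} (h : Bad γ n) :
    (hankel γ n).det = 0 := by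
  obtain ⟨X, Y, hX, hY, hY0, hYn, hXY⟩ := h
  refine Matrix.exists_mulVec_eq_zero_iff.1 ⟨fun j => Y.coeff (-(j : ℤ)), fun h0 => hY0 ?_, ?_⟩
  · rw [hY.eq_sum hYn]
    refine Finset.sum_eq_zero fun j _ => ?_
    rw [show Y.coeff (-(j : ℤ)) = 0 from congrFun h0 j, zero_smul]
  · funext i
    rw [hankel_mulVec, ← hY.eq_sum hYn]
    have h1 := hXY (i + 1) (by omega)
    rw [HahnSeries.coeff_sub, hX _ (by omega), zero_sub, neg_eq_zero] at h1
    exact h1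

theorem bad_mapL_iff [IsDomain R] {R' : Type*} [CommRing R'] [IsDomain R'] {φ : R →+* R'}
    (hφ : Function.Injective φ) {γ : LaurentSeries R} {n : ℕ} :
    Bad (mapL φ γ) n ↔ Bad γ n := by
  have hdet : (hankel (mapL φ γ) n).det = φ (hankel γ n).det := by
    rw [RingHom.map_det]
    rfl
  refine ⟨fun h => bad_of_det_eq_zero (hφ ?_), fun h => bad_of_det_eq_zero ?_⟩
  · rw [← hdet, det_eq_zero_of_bad h, map_zero]
  · rw [hdet, det_eq_zero_of_bad h, map_zero]

end Hankel

section Choice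

open Polynomial

variable {F : Type*} [Field F]

/-- `γ` has no rational approximation of quality better than `k` with denominator of degree at
most `B`. -/
def BadlyApprox (γ : LaurentSeries F) (k B : ℕ) : Prop :=
  ∀ X Y : F[X], Y ≠ 0 → Y.natDegree ≤ B →
    ¬ OrdGe ((Y.natDegree : ℤ) + k + 1) (pemb F X - pemb F Y * γ)

theorem badlyApprox_sqrt {D : F[X]} (hD : ¬ IsSquare D) {β : LaurentSeries F}
    (hβ : β ^ 2 = pemb F D) {d : ℕ} (hβo : OrdGe (-(d : ℤ)) β) (B : ℕ) : BadlyApprox β d B := by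
  intro X Y hY _ h
  have hYβ : OrdGe (-(Y.natDegree : ℤ) + -(d : ℤ)) (pemb F Y * β) := (ordGe_pemb Y le_rfl).mul hβo
  have h1 : OrdGe (-(Y.natDegree : ℤ) + -(d : ℤ)) (pemb F X + pemb F Y * β) := by
    have : pemb F X + pemb F Y * β
        = (pemb F X - pemb F Y * β) + (pemb F Y * β + pemb F Y * β) := by ring
    rw [this]
    exact (h.mono (by omega)).add (hYβ.add hYβ)
  have h2 : pemb F (X ^ 2 - D * Y ^ 2)
      = (pemb F X - pemb F Y * β) * (pemb F X + pemb F Y * β) := by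
    simp only [map_sub, map_mul, map_pow, ← hβ]
    ring
  have h3 : pemb F (X ^ 2 - D * Y ^ 2) = 0 :=
    (isPoly_pemb _).eq_zero (h2 ▸ (h.mul h1).mono (by omega))
  have h4 : X ^ 2 - D * Y ^ 2 = 0 := pemb_injective (by rw [h3, map_zero])
  obtain ⟨w, rfl⟩ : Y ∣ X := by
    rw [← IsIntegrallyClosed.pow_dvd_pow_iff two_ne_zero]
    exact ⟨D, by linear_combination h4⟩
  refine hD ⟨w, mul_left_cancel₀ (pow_ne_zero 2 hY) ?_⟩
  linear_combination -h4

theorem ordGe_of_mul_X_sub_C {f : LaurentSeries F} {x : F} {a : ℤ}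
    (h : OrdGe a (pemb F (X - C x) * f)) : OrdGe (a + 1) f := by
  by_cases hf : f = 0
  · rw [hf]
    exact ordGe_zero _
  have hx : pemb F (X - C x) ≠ 0 := by
    rw [Ne, map_eq_zero_iff _ pemb_injective]
    exact X_sub_C_ne_zero x
  have ho : (pemb F (X - C x)).order = -1 := by
    refine order_eq_of_coeff ?_ ?_
    · exact ordGe_pemb (X - C x) (natDegree_X_sub_C x).le
    · have := coeff_pemb (X - C x) 1
      rw [Nat.cast_one] at this
      rw [this]
      simp [coeff_X]
  have := h.le_order (mul_ne_zero hx hf)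
  rw [order_mul_of_ne hx hf, ho] at this
  exact ordGe_of_le_order (by omega)

theorem BadlyApprox.exists_step {γ : LaurentSeries F} {k B : ℕ} (hk : 1 ≤ k)
    (h : BadlyApprox γ (k + 1) (B + 1)) {S : Set F} (hS : S.Infinite) :
    ∃ x ∈ S, BadlyApprox (pemb F (X - C x) * γ) k B := by
  have hq : ∀ j : ℕ, ∃ Q : F[X], Q ≠ 0 ∧ ∀ x, ∀ U V : F[X], V ≠ 0 → V.natDegree = j →
      OrdGe ((j : ℤ) + 1) (pemb F U - pemb F V * γ) → V.IsRoot x → U.eval x ≠ 0 → Q.IsRoot x := by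
    intro j
    by_cases hj : ∃ U V : F[X], V ≠ 0 ∧ V.natDegree = j ∧
      OrdGe ((j : ℤ) + 1) (pemb F U - pemb F V * γ)
    · obtain ⟨U', V', hV', hVj', hUV'⟩ := hj
      refine ⟨V', hV', fun x U V _ hVj hUV hVx hUx => ?_⟩
      have h1 : pemb F (U * V' - U' * V) = pemb F V' * (pemb F U - pemb F V * γ)
          - pemb F V * (pemb F U' - pemb F V' * γ) := by
        simp only [map_sub, map_mul]
        ring
      have h2 : pemb F (U * V' - U' * V) = 0 := by
        refine (isPoly_pemb _).eq_zero ?_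
        rw [h1]
        exact (((ordGe_pemb V' hVj'.le).mul hUV).mono (by omega)).sub
          (((ordGe_pemb V hVj.le).mul hUV').mono (by omega))
      have h3 : U * V' - U' * V = 0 := pemb_injective (by rw [h2, map_zero])
      have h4 := congrArg (eval x) h3
      simp only [eval_sub, eval_mul, hVx.eq_zero, mul_zero, sub_zero, eval_zero] at h4
      exact (mul_eq_zero.1 h4).resolve_left hUx
    · exact ⟨1, one_ne_zero, fun x U V hV hVj hUV => (hj ⟨U, V, hV, hVj, hUV⟩).elim⟩
  classical
  choose Q hQ0 hQ using hq
  have hP : ∏ j ∈ Finset.range (B + 2), Q j ≠ 0 := Finset.prod_ne_zero_iff.2 fun j _ => hQ0 j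
  obtain ⟨x, hxS, hx⟩ := hS.exists_notMem_finset (∏ j ∈ Finset.range (B + 2), Q j).roots.toFinset
  refine ⟨x, hxS, fun U V hV hVB hUV => ?_⟩
  by_cases hU : U.IsRoot x
  · obtain ⟨U₂, rfl⟩ := dvd_iff_isRoot.2 hU
    refine h U₂ V hV (by omega) ?_
    have e : pemb F ((X - C x) * U₂) - pemb F V * (pemb F (X - C x) * γ)
        = pemb F (X - C x) * (pemb F U₂ - pemb F V * γ) := by
      rw [map_mul]
      ring
    rw [e] at hUV
    exact (ordGe_of_mul_X_sub_C hUV).mono (by push_cast; omega)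
  · have hV1 : (V * (X - C x)).natDegree = V.natDegree + 1 := by
      rw [natDegree_mul hV (X_sub_C_ne_zero x), natDegree_X_sub_C]
    have hroot := hQ (V.natDegree + 1) x U (V * (X - C x)) (mul_ne_zero hV (X_sub_C_ne_zero x))
      hV1 (by
        rw [map_mul, mul_assoc]
        exact hUV.mono (by push_cast; omega)) (by simp) hU
    apply hx
    rw [Multiset.mem_toFinset, mem_roots hP, IsRoot, eval_prod]
    exact Finset.prod_eq_zero (Finset.mem_range.2 (by omega : V.natDegree + 1 < B + 2)) hroot

theorem BadlyApprox.exists_prod {S : Set F} (hS : S.Infinite) (B n : ℕ) :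
    ∀ γ : LaurentSeries F, BadlyApprox γ (n + 1) (B + n) → ∃ lam : Fin n → F, (∀ j, lam j ∈ S) ∧
      BadlyApprox (pemb F (∏ j, (X - C (lam j))) * γ) 1 B := by
  induction n with
  | zero =>
    intro γ h
    exact ⟨Fin.elim0, fun j => j.elim0, by simpa using h⟩
  | succ n ih =>
    intro γ h
    obtain ⟨x, hx, h1⟩ := BadlyApprox.exists_step (by omega) h hS
    obtain ⟨lam, hlam, h2⟩ := ih _ h1
    refine ⟨Fin.cons x lam, fun j => Fin.cases hx hlam j, ?_⟩
    rw [Fin.prod_univ_succ]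
    simp only [Fin.cons_zero, Fin.cons_succ]
    rwa [mul_comm (X - C x), map_mul, mul_assoc]

theorem BadlyApprox.not_bad {γ : LaurentSeries F} {B : ℕ} (h : BadlyApprox γ 1 B) {a : ℕ}
    (ha : a ≤ B) : ¬ Bad γ a := by
  rintro ⟨U, V, hU, hV, hV0, hVa, hUV⟩
  obtain ⟨U, rfl⟩ := hU.exists_pemb
  obtain ⟨V, rfl⟩ := hV.exists_pemb
  have hV1 : V ≠ 0 := by
    rintro rfl
    exact hV0 (map_zero _)
  have hdeg : V.natDegree + 1 ≤ a := by
    by_contra! hlt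
    have := hVa (-(V.natDegree : ℤ)) (by omega)
    rw [coeff_pemb] at this
    exact leadingCoeff_ne_zero.2 hV1 this
  exact h U V hV1 (by omega) (hUV.mono (by push_cast; omega))

end Choice

section Lift

variable {p : ℕ} [hp : Fact p.Prime]

theorem exists_mapL_eq_of_norm_le {g : LaurentSeries ℚ_[p]} (h : ∀ i, ‖g.coeff i‖ ≤ 1) :
    ∃ f : LaurentSeries ℤ_[p], mapL (algebraMap ℤ_[p] ℚ_[p]) f = g := by
  refine ⟨⟨fun i => ⟨g.coeff i, h i⟩, g.isPWO_support.mono fun i hi => ?_⟩, ?_⟩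
  · rw [HahnSeries.mem_support]
    intro h0
    exact hi (Subtype.ext h0)
  · ext i
    rw [coeff_mapL]
    rfl

theorem exists_mapL_eq_of_sq (hp2 : p ≠ 2) {g : LaurentSeries ℚ_[p]} {a : ℤ} (hg : OrdGe a g)
    (ha : ‖g.coeff a‖ = 1) (h2 : ∀ i, ‖(g ^ 2).coeff i‖ ≤ 1) :
    ∃ f : LaurentSeries ℤ_[p], mapL (algebraMap ℤ_[p] ℚ_[p]) f = g := by
  have h2n : ‖(2 : ℚ_[p])‖ = 1 := by
    have := PadicInt.isUnit_iff.1 (isUnit_two hp2)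
    exact_mod_cast this
  have key : ∀ n : ℕ, ∀ i < a + 1 + n, ‖g.coeff i‖ ≤ 1 := by
    intro n
    induction n with
    | zero =>
      intro i hi
      rcases (show i < a ∨ i = a by push_cast at hi; omega) with h | rfl
      · rw [hg i h, norm_zero]
        exact zero_le_one
      · exact ha.le
    | succ n ih =>
      intro i hi
      rcases (show i < a + 1 + n ∨ i = a + 1 + n by push_cast at hi; omega) with h | rfl
      · exact ih i h
      set t := trunc (a + n) g with ht
      set r := g - t with hr
      have hrge : OrdGe (a + 1 + n) r := (ordGe_sub_trunc (a + n) g).mono (by omega)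
      have htge : OrdGe a t := fun i hi => by
        rw [ht, coeff_trunc, hg i hi, ite_self]
      obtain ⟨f, hf⟩ := exists_mapL_eq_of_norm_le (g := t) fun i => by
        rw [ht, coeff_trunc]
        split_ifs with hi
        · exact ih i (by omega)
        · simp
      have hta : t.coeff a = g.coeff a := by
        rw [ht, coeff_trunc, if_pos (by omega)]
      have hgr : g.coeff (a + 1 + n) = r.coeff (a + 1 + n) := by
        rw [hr, HahnSeries.coeff_sub, ht, coeff_trunc, if_neg (by omega), sub_zero]
      have hsq : g ^ 2 = t ^ 2 + (t * r + t * r) + r * r := by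
        rw [hr]
        ring
      have hrr : (r * r).coeff (a + (a + 1 + n)) = 0 := (hrge.mul hrge) _ (by omega)
      have h3 : (g ^ 2).coeff (a + (a + 1 + n))
          = (t ^ 2).coeff (a + (a + 1 + n)) + 2 * (g.coeff a * g.coeff (a + 1 + n)) := by
        rw [hsq, HahnSeries.coeff_add, HahnSeries.coeff_add, HahnSeries.coeff_add, hrr,
          coeff_mul_of_ordGe htge hrge, hta, hgr]
        ring
      have h4 : ‖(t ^ 2).coeff (a + (a + 1 + n))‖ ≤ 1 := by
        rw [← hf, ← map_pow, coeff_mapL]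
        exact PadicInt.norm_le_one _
      have h5 : ‖2 * (g.coeff a * g.coeff (a + 1 + n))‖ ≤ 1 := by
        rw [← sub_eq_of_eq_add' h3, sub_eq_add_neg]
        exact (Padic.nonarchimedean _ _).trans (max_le (h2 _) (by rwa [norm_neg]))
      rwa [norm_mul, norm_mul, h2n, ha, one_mul, one_mul] at h5
  refine exists_mapL_eq_of_norm_le fun i => key (i - a).toNat i (by omega)

end Lift

section Main

open Polynomial

theorem order_pemb {F : Type*} [Field F] {P : F[X]} (hP : P ≠ 0) :
    (pemb F P).order = -(P.natDegree : ℤ) := by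
  refine order_eq_of_coeff (ordGe_pemb P le_rfl) ?_
  rw [coeff_pemb]
  exact leadingCoeff_ne_zero.2 hP

theorem order_sqrt {F : Type*} [Field F] {D : F[X]} {d : ℕ} (hD : D ≠ 0)
    (hd : D.natDegree = 2 * d) {β : LaurentSeries F} (hβ : β ^ 2 = pemb F D) :
    β ≠ 0 ∧ β.order = -(d : ℤ) := by
  have hβ0 : β ≠ 0 := by
    rintro rfl
    apply hD
    apply pemb_injective
    rw [← hβ, map_zero, zero_pow two_ne_zero]
  have h1 := congrArg HahnSeries.order hβ
  rw [order_pemb hD, hd, sq, order_mul_of_ne hβ0 hβ0] at h1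
  exact ⟨hβ0, by push_cast at h1; omega⟩

theorem not_isPoly_sqrt {F : Type*} [Field F] {D : F[X]} (hD : ¬ IsSquare D)
    {β : LaurentSeries F} (hβ : β ^ 2 = pemb F D) : ¬ IsPoly β := by
  intro h
  obtain ⟨w, rfl⟩ := h.exists_pemb
  refine hD ⟨w, pemb_injective ?_⟩
  rw [← hβ, map_mul, sq]

/-- For a square root `β` of a polynomial of degree `2d` over a number field, one can choose
linear factors such that their product with `β` has only finitely many too good
approximations. -/
theorem exists_finite_bad_prod {K : Type*} [Field K] [NumberField K] {D : K[X]}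
    (hD : ¬ IsSquare D) {n : ℕ} (hd : D.natDegree = 2 * (n + 1)) {β : LaurentSeries K}
    (hβ : β ^ 2 = pemb K D) :
    ∃ lam : Fin n → K, {i | Bad (pemb K (∏ j, (X - C (lam j))) * β) i}.Finite := by
  classical
  have hD0 : D ≠ 0 := by
    rintro rfl
    exact hD ⟨0, by simp⟩
  obtain ⟨hβ0, hord⟩ := order_sqrt hD0 hd hβ
  have hβo : OrdGe (-((n + 1 : ℕ) : ℤ)) β := ordGe_of_le_order hord.ge
  set b := β.coeff (-((n + 1 : ℕ) : ℤ)) with hb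
  have hb0 : b ≠ 0 := by
    rw [hb, ← hord]
    exact HahnSeries.coeff_order_eq_zero.not.2 hβ0
  obtain ⟨i₀, hi₀, hc⟩ : ∃ i : ℤ, 0 < i ∧ (pemb K (X ^ n) * β).coeff i ≠ 0 := by
    by_contra! h
    refine not_isPoly_sqrt hD hβ (isPoly_of_mul_eq (hβ ▸ isPoly_pemb D) h (isPoly_pemb (X ^ n))
      ?_ rfl)
    rw [Ne, map_eq_zero_iff _ pemb_injective]
    exact pow_ne_zero _ X_ne_zero
  set c := (pemb K (X ^ n) * β).coeff i₀ with hcdef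
  obtain ⟨p, hp, hp2, ι, hι⟩ := exists_padic_embedding (insert b (insert b⁻¹ (insert c⁻¹ D.coeffs)))
  have hιb : ‖ι b‖ = 1 := by
    refine le_antisymm (hι b (by simp)) ?_
    have h1 := hι b⁻¹ (by simp)
    rwa [map_inv₀, norm_inv, inv_le_one₀ (norm_pos_iff.2 ((map_ne_zero ι).2 hb0))] at h1
  have hιc : 1 ≤ ‖ι c‖ := by
    have h1 := hι c⁻¹ (by simp)
    rwa [map_inv₀, norm_inv, inv_le_one₀ (norm_pos_iff.2 ((map_ne_zero ι).2 hc))] at h1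
  have hιD : ∀ i, ‖ι ((pemb K D).coeff i)‖ ≤ 1 := by
    intro i
    by_cases h0 : (pemb K D).coeff i = 0
    · rw [h0, map_zero, norm_zero]
      exact zero_le_one
    · have hi : i ≤ 0 := not_lt.1 fun h => h0 (isPoly_pemb D i h)
      obtain ⟨k, rfl⟩ : ∃ k : ℕ, i = -(k : ℤ) := ⟨i.natAbs, by omega⟩
      rw [coeff_pemb] at h0 ⊢
      refine hι _ ?_
      simp only [Finset.mem_insert]
      exact Or.inr (Or.inr (Or.inr (coeff_mem_coeffs h0)))
  set alg := algebraMap ℤ_[p] ℚ_[p] with halg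
  have halg_inj : Function.Injective alg := IsFractionRing.injective ℤ_[p] ℚ_[p]
  have halg_norm : ∀ x : ℤ_[p], ‖alg x‖ = ‖x‖ := fun x => rfl
  obtain ⟨βp, hβp⟩ := exists_mapL_eq_of_sq hp2 (g := mapL ι β) (hβo.mapL ι)
    (by rw [coeff_mapL]; exact hιb) (fun i => by
      rw [← map_pow, hβ, coeff_mapL]
      exact hιD i)
  have hβp_coeff : ∀ i, alg (βp.coeff i) = ι (β.coeff i) := fun i => by
    rw [← coeff_mapL, hβp, coeff_mapL]
  have hβpo : OrdGe (-((n + 1 : ℕ) : ℤ)) βp := fun i hi => halg_inj (by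
    rw [hβp_coeff, hβo i hi, map_zero, map_zero])
  have hβp2 : IsPoly (βp ^ 2) := fun i hi => halg_inj (by
    rw [← coeff_mapL, map_pow, hβp, ← map_pow, hβ, coeff_mapL, isPoly_pemb D i hi, map_zero,
      map_zero])
  have hord_of : ∀ P : ℤ_[p][X], P.natDegree ≤ n →
      OrdGe (-((n + (n + 1) : ℕ) : ℤ)) (pemb ℤ_[p] P * βp) := fun P hP =>
    ((ordGe_pemb P hP).mul hβpo).mono (by push_cast; omega)
  have hsq_of : ∀ P : ℤ_[p][X], IsPoly ((pemb ℤ_[p] P * βp) ^ 2) := fun P => by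
    rw [mul_pow, ← map_pow]
    exact (isPoly_pemb _).mul hβp2
  have hunit : ∀ x : ℤ_[p], ‖x‖ = 1 → PadicInt.toZMod x ≠ 0 := fun x hx =>
    ((PadicInt.isUnit_iff.2 hx).map PadicInt.toZMod).ne_zero
  obtain ⟨m, hm⟩ := exists_threshold hp2
    (Γ := mapL PadicInt.toZMod (pemb ℤ_[p] (X ^ n) * βp)) (e := n + (n + 1)) (by omega)
    ((hord_of _ (natDegree_X_pow_le n)).mapL _)
    (by
      rw [coeff_mapL]
      refine hunit _ ?_
      have h1 := coeff_mul_of_ordGe (ordGe_pemb (X ^ n : ℤ_[p][X]) (natDegree_X_pow_le n)) hβpo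
      rw [coeff_pemb, coeff_X_pow_self, one_mul] at h1
      rw [show (-((n + (n + 1) : ℕ) : ℤ)) = -(n : ℤ) + -((n + 1 : ℕ) : ℤ) by push_cast; ring, h1,
        ← halg_norm, hβp_coeff]
      exact hιb)
    (by
      rw [← map_pow]
      exact (hsq_of _).mapL _)
    (by
      intro h
      have h1 := h i₀ hi₀
      rw [coeff_mapL] at h1
      refine hunit _ (le_antisymm (PadicInt.norm_le_one _) ?_) h1
      rw [← halg_norm, ← coeff_mapL, map_mul, hβp, mapL_pemb, Polynomial.map_pow, map_X]
      rwa [hcdef, ← coeff_mapL, map_mul, mapL_pemb, Polynomial.map_pow, map_X] at hιc)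
  have hS : (Set.range fun k : ℤ => ((p * k : ℤ) : K)).Infinite :=
    Set.infinite_range_of_injective fun x y hxy => by
      have h1 : (p * x : ℤ) = p * y := Int.cast_injective hxy
      exact mul_left_cancel₀ (by exact_mod_cast hp.out.ne_zero) h1
  obtain ⟨lam, hlam, hbad⟩ := BadlyApprox.exists_prod hS m n β
    (badlyApprox_sqrt hD hβ hβo (m + n))
  choose k hk using hlam
  refine ⟨lam, ?_⟩
  set P : ℤ_[p][X] := ∏ j, (X - C ((p * k j : ℤ) : ℤ_[p])) with hP
  have hiff : ∀ i, Bad (pemb K (∏ j, (X - C (lam j))) * β) i ↔ Bad (pemb ℤ_[p] P * βp) i := by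
    intro i
    rw [← bad_mapL_iff ι.injective, ← bad_mapL_iff halg_inj, map_mul, map_mul, hβp, mapL_pemb,
      mapL_pemb, hP, Polynomial.map_prod, Polynomial.map_prod]
    simp only [Polynomial.map_sub, map_X, map_intCast, Polynomial.map_intCast, ← hk]
  simp only [hiff]
  refine hm _ ?_ (hord_of _ ?_) (hsq_of _) fun a ha h => hbad.not_bad ha.le ((hiff a).2 h)
  · rw [map_mul, map_mul, mapL_pemb, mapL_pemb, hP, Polynomial.map_prod, Polynomial.map_pow]
    simp
  · rw [hP, natDegree_prod_of_monic _ _ fun j _ => monic_X_sub_C _]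
    simp only [natDegree_X_sub_C, Finset.sum_const, Finset.card_univ, Fintype.card_fin,
      smul_eq_mul, mul_one, le_refl]

end Main

open Polynomial

section ContinuedFraction

variable {K : Type*} [Field K]

theorem pemb_polyPart (α : LaurentSeries K) : pemb K (polyPart α) = trunc 0 α := by
  ext i
  rw [coeff_trunc]
  split_ifs with hi
  · obtain ⟨k, rfl⟩ : ∃ k : ℕ, i = -(k : ℤ) := ⟨i.natAbs, by omega⟩
    rw [coeff_pemb, polyPart, finsetSum_coeff]
    simp only [coeff_monomial, Finset.sum_ite_eq', Finset.mem_range]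
    split_ifs with hk
    · rfl
    · exact (ordGe_order (f := α) _ (by omega)).symm
  · exact isPoly_pemb _ _ (by omega)

theorem cq_succ (α : LaurentSeries K) (n : ℕ) :
    cq α (n + 1) = (cq α n - pemb K (pq α n))⁻¹ := by
  rw [cq, emb_eq_pemb]
  rfl

theorem ordGe_cq_sub (α : LaurentSeries K) (n : ℕ) : OrdGe 1 (cq α n - pemb K (pq α n)) := by
  rw [pq, pemb_polyPart]
  exact ordGe_sub_trunc 0 _

theorem cq_cq (α : LaurentSeries K) (m n : ℕ) : cq (cq α m) n = cq α (m + n) := by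
  induction n with
  | zero => rfl
  | succ n ih => rw [cq, ih]; rfl

theorem pq_cq (α : LaurentSeries K) (m n : ℕ) : pq (cq α m) n = pq α (m + n) := by
  rw [pq, cq_cq, pq]

/-- `α` is not a rational function. -/
def Irrat (α : LaurentSeries K) : Prop :=
  ∀ U V : K[X], V ≠ 0 → pemb K V * α ≠ pemb K U

theorem Irrat.sub_ne_zero {α : LaurentSeries K} (h : Irrat α) (U : K[X]) :
    α - pemb K U ≠ 0 := fun h0 =>
  h U 1 one_ne_zero (by rw [map_one, one_mul, _root_.sub_eq_zero.1 h0])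

theorem Irrat.cq {α : LaurentSeries K} (h : Irrat α) (n : ℕ) : Irrat (cq α n) := by
  induction n with
  | zero => exact h
  | succ n ih =>
    intro U V hV hUV
    rw [cq_succ] at hUV
    have h0 := ih.sub_ne_zero (pq α n)
    have hU : U ≠ 0 := by
      rintro rfl
      rw [map_zero] at hUV
      refine mul_ne_zero ?_ (inv_ne_zero h0) hUV
      rwa [Ne, map_eq_zero_iff _ pemb_injective]
    refine ih (V + U * pq α n) U hU ?_
    rw [map_add, map_mul, ← hUV]
    field_simp
    ring

theorem Irrat.ne_zero {α : LaurentSeries K} (h : Irrat α) : α ≠ 0 := by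
  have := h.sub_ne_zero 0
  rwa [map_zero, sub_zero] at this

theorem order_inv' {f : LaurentSeries K} (hf : f ≠ 0) : f⁻¹.order = -f.order := by
  have h1 := order_mul_of_ne hf (inv_ne_zero hf)
  rw [mul_inv_cancel₀ hf, HahnSeries.order_one] at h1
  omega

theorem order_add_of_ordGe {f g : LaurentSeries K} (hf : f ≠ 0) (hg : OrdGe (f.order + 1) g) :
    (f + g).order = f.order := by
  refine order_eq_of_coeff (ordGe_order.add (hg.mono (by omega))) ?_
  rw [HahnSeries.coeff_add, hg _ (by omega), add_zero]
  exact HahnSeries.coeff_order_eq_zero.not.2 hf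

theorem natDegree_polyPart {α : LaurentSeries K} (hα : α ≠ 0) (h : α.order ≤ 0) :
    ((polyPart α).natDegree : ℤ) = -α.order := by
  have h1 : (pemb K (polyPart α)).order = α.order := by
    rw [pemb_polyPart]
    refine order_eq_of_coeff (fun i hi => ?_) ?_
    · rw [coeff_trunc, ordGe_order i hi, ite_self]
    · rw [coeff_trunc, if_pos h]
      exact HahnSeries.coeff_order_eq_zero.not.2 hα
  have h2 : polyPart α ≠ 0 := by
    intro h0
    have h3 := pemb_polyPart α
    rw [h0, map_zero] at h3
    have h4 := congrArg (fun f => f.coeff α.order) h3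
    simp only [coeff_trunc, if_pos h] at h4
    exact HahnSeries.coeff_order_eq_zero.not.2 hα h4.symm
  rw [order_pemb h2] at h1
  omega

theorem Irrat.natDegree_pq_succ {α : LaurentSeries K} (h : Irrat α) (n : ℕ) :
    ((pq α (n + 1)).natDegree : ℤ) = -(PaperCF.cq α (n + 1)).order ∧
      1 ≤ (pq α (n + 1)).natDegree := by
  have h0 := (h.cq n).sub_ne_zero (pq α n)
  have h1 : 1 ≤ -(PaperCF.cq α (n + 1)).order := by
    rw [cq_succ, order_inv' h0, neg_neg]
    exact (ordGe_cq_sub α n).le_order h0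
  have h2 : ((pq α (n + 1)).natDegree : ℤ) = -(PaperCF.cq α (n + 1)).order :=
    natDegree_polyPart (h.cq (n + 1)).ne_zero (by omega)
  exact ⟨h2, by omega⟩

/-- The convergents of `α` and the quality of approximation they provide. -/
theorem Irrat.exists_convergent (j : ℕ) : ∀ {α : LaurentSeries K}, Irrat α →
    ∃ U V : K[X], V ≠ 0 ∧ V.natDegree = ∑ i ∈ Finset.range j, (pq α (i + 1)).natDegree ∧
      pemb K U - pemb K V * α ≠ 0 ∧ (pemb K U - pemb K V * α).order
        = ((∑ i ∈ Finset.range (j + 1), (pq α (i + 1)).natDegree : ℕ) : ℤ) := by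
  induction j with
  | zero =>
    intro α h
    have h0 := h.sub_ne_zero (pq α 0)
    have e : pemb K (pq α 0) - pemb K 1 * α = -(α - pemb K (pq α 0)) := by
      rw [map_one]
      ring
    refine ⟨pq α 0, 1, one_ne_zero, by simp, ?_, ?_⟩
    · rw [e]
      exact neg_ne_zero.2 h0
    · rw [e, HahnSeries.order_neg, Finset.sum_range_one, (h.natDegree_pq_succ 0).1, cq_succ]
      exact ((congrArg Neg.neg (order_inv' h0)).trans (neg_neg _)).symm
  | succ j ih =>
    intro α h
    obtain ⟨U, V, hV, hVd, hUV, hUVo⟩ := ih (h.cq 1)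
    simp only [pq_cq] at hVd hUVo
    have h0 := h.sub_ne_zero (pq α 0)
    have hα1 : PaperCF.cq α 1 = (α - pemb K (pq α 0))⁻¹ := cq_succ α 0
    have hα10 := (h.cq 1).ne_zero
    obtain ⟨hd, hd1⟩ := h.natDegree_pq_succ 0
    rw [zero_add] at hd hd1
    have hV0 : pemb K V ≠ 0 := by rwa [Ne, map_eq_zero_iff _ pemb_injective]
    have hVα0 : pemb K V * PaperCF.cq α 1 ≠ 0 := mul_ne_zero hV0 hα10
    have hVα : (pemb K V * PaperCF.cq α 1).order = -((V.natDegree + (pq α 1).natDegree : ℕ) : ℤ) := by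
      rw [order_mul_of_ne hV0 hα10, order_pemb hV]
      push_cast
      omega
    have hUo : (pemb K U).order = -((V.natDegree + (pq α 1).natDegree : ℕ) : ℤ) := by
      have e : pemb K U = pemb K V * PaperCF.cq α 1
          + (pemb K U - pemb K V * PaperCF.cq α 1) := by ring
      rw [e, order_add_of_ordGe hVα0, hVα]
      refine ordGe_of_le_order ?_
      rw [hVα, hUVo]
      have : (0 : ℤ) ≤ ((∑ i ∈ Finset.range (j + 1), (pq α (1 + (i + 1))).natDegree : ℕ) : ℤ) :=
        Int.natCast_nonneg _
      omega
    have hU : U ≠ 0 := by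
      rintro rfl
      rw [map_zero, HahnSeries.order_zero] at hUo
      push_cast at hUo
      omega
    have hUd : U.natDegree = V.natDegree + (pq α 1).natDegree := by
      rw [order_pemb hU] at hUo
      omega
    have e : pemb K (V + U * pq α 0) - pemb K U * α
        = -((pemb K U - pemb K V * PaperCF.cq α 1) * (α - pemb K (pq α 0))) := by
      rw [hα1, sub_mul, mul_assoc, inv_mul_cancel₀ h0, map_add, map_mul]
      ring
    refine ⟨V + U * pq α 0, U, hU, ?_, ?_, ?_⟩
    · rw [hUd, hVd, Finset.sum_range_succ', zero_add]
      congr 1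
      exact Finset.sum_congr rfl fun i _ => by rw [add_comm 1]
    · rw [e]
      exact neg_ne_zero.2 (mul_ne_zero hUV h0)
    · rw [e, HahnSeries.order_neg, order_mul_of_ne hUV h0, hUVo,
        Finset.sum_range_succ' _ (j + 1), zero_add, Nat.cast_add, hd, hα1, order_inv' h0, neg_neg]
      congr 2
      exact Finset.sum_congr rfl fun i _ => by rw [add_comm 1]

/-- If `α` has finitely many too good approximations, almost all of its partial quotients have
degree one. -/
theorem Irrat.eventually_natDegree_eq_one {α : LaurentSeries K} (h : Irrat α)
    (hfin : {i | Bad α i}.Finite) : ∃ N, ∀ n, N ≤ n → (pq α n).natDegree = 1 := by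
  obtain ⟨M, hM⟩ := hfin.bddAbove
  refine ⟨M + 1, fun n hn => ?_⟩
  obtain ⟨j, rfl⟩ : ∃ j, n = j + 1 := ⟨n - 1, by omega⟩
  refine le_antisymm ?_ (h.natDegree_pq_succ j).2
  by_contra! h2
  obtain ⟨U, V, hV, hVd, hUV, hUVo⟩ := h.exists_convergent j
  have hj : j ≤ V.natDegree := by
    rw [hVd]
    calc j = ∑ i ∈ Finset.range j, 1 := by simp
      _ ≤ _ := Finset.sum_le_sum fun i _ => (h.natDegree_pq_succ i).2
  have hbad : Bad α (V.natDegree + 1) := by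
    refine ⟨_, _, isPoly_pemb U, isPoly_pemb V, ?_, ?_, ordGe_of_le_order ?_⟩
    · rwa [Ne, map_eq_zero_iff _ pemb_injective]
    · exact (ordGe_pemb V le_rfl).mono (by push_cast; omega)
    · rw [hUVo, Finset.sum_range_succ, ← hVd]
      push_cast
      omega
  have := hM hbad
  omega

theorem KKbar_eq_one {α : LaurentSeries K} {N : ℕ} (hN : ∀ n, N ≤ n → (pq α n).natDegree = 1) :
    KKbar α = 1 := by
  rw [KKbar, Filter.limsup_congr (v := fun _ => (1 : ℕ∞)), Filter.limsup_const]
  filter_upwards [Filter.eventually_ge_atTop N] with n hn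
  rw [hN n hn, Nat.cast_one]

theorem Irrat.KK_cq_eq_one {α : LaurentSeries K} (h : Irrat α) {N : ℕ}
    (hN : ∀ n, N ≤ n → (pq α n).natDegree = 1) : KK (PaperCF.cq α N) = 1 := by
  have : Nonempty {n : ℕ // 1 ≤ n ∧ PaperCF.cq (PaperCF.cq α N) n ≠ 0} :=
    ⟨1, le_rfl, ((h.cq N).cq 1).ne_zero⟩
  rw [KK]
  simp only [pq_cq, hN _ (Nat.le_add_right N _), Nat.cast_one, ciSup_const]

end ContinuedFraction

section Equivalence

variable {K : Type*} [Field K]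

theorem isUnit_pemb_ne_zero {u : K[X]} (hu : IsUnit u) : pemb K u ≠ 0 :=
  (hu.map (pemb K)).ne_zero

theorem mEquiv_symm {α β : LaurentSeries K} (h : MEquiv α β) : MEquiv β α := by
  obtain ⟨a, b, c, d, hu, h0, rfl⟩ := h
  simp only [MEquiv, emb_eq_pemb] at *
  have hu0 := isUnit_pemb_ne_zero hu
  rw [map_sub, map_mul, map_mul] at hu0
  have h1 : pemb K (-c) * ((pemb K a * α + pemb K b) / (pemb K c * α + pemb K d)) + pemb K a
      = (pemb K a * pemb K d - pemb K b * pemb K c) / (pemb K c * α + pemb K d) := by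
    rw [map_neg, eq_div_iff h0, add_mul, mul_assoc, div_mul_cancel₀ _ h0]
    ring
  have h2 : pemb K d * ((pemb K a * α + pemb K b) / (pemb K c * α + pemb K d)) + pemb K (-b)
      = (pemb K a * pemb K d - pemb K b * pemb K c) * α / (pemb K c * α + pemb K d) := by
    rw [map_neg, eq_div_iff h0, add_mul, mul_assoc, div_mul_cancel₀ _ h0]
    ring
  refine ⟨d, -b, -c, a, by convert hu using 1; ring, ?_, ?_⟩
  · rw [h1]
    exact div_ne_zero hu0 h0
  · rw [h1, h2, div_div_div_cancel_right₀ h0, mul_div_cancel_left₀ _ hu0]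

theorem mEquiv_trans {α β γ : LaurentSeries K} (h : MEquiv α β) (h' : MEquiv β γ) :
    MEquiv α γ := by
  obtain ⟨a, b, c, d, hu, h0, rfl⟩ := h
  obtain ⟨a', b', c', d', hu', h0', rfl⟩ := h'
  simp only [MEquiv, emb_eq_pemb] at *
  have h1 : ∀ x y : K[X], pemb K x * ((pemb K a * α + pemb K b) / (pemb K c * α + pemb K d))
      + pemb K y = (pemb K (x * a + y * c) * α + pemb K (x * b + y * d))
        / (pemb K c * α + pemb K d) := fun x y => by
    rw [eq_div_iff h0, add_mul, mul_assoc, div_mul_cancel₀ _ h0]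
    simp only [map_add, map_mul]
    ring
  refine ⟨a' * a + b' * c, a' * b + b' * d, c' * a + d' * c, c' * b + d' * d, ?_, ?_, ?_⟩
  · convert hu'.mul hu using 1
    ring
  · rw [h1] at h0'
    exact fun h2 => h0' (by rw [h2, zero_div])
  · rw [h1, h1, div_div_div_cancel_right₀ h0]

theorem Irrat.mEquiv_cq {α : LaurentSeries K} (h : Irrat α) (n : ℕ) :
    MEquiv α (PaperCF.cq α n) := by
  induction n with
  | zero => exact ⟨1, 0, 0, 1, by simp, by simp, by simp [PaperCF.cq]⟩
  | succ n ih =>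
    refine mEquiv_trans ih ⟨0, 1, 1, -pq α n, by simp, ?_, ?_⟩
    · rw [emb_eq_pemb, map_one, one_mul, map_neg, ← sub_eq_add_neg]
      exact (h.cq n).sub_ne_zero _
    · rw [cq_succ, emb_eq_pemb, map_one, one_mul, map_neg, ← sub_eq_add_neg, map_zero, zero_mul,
        zero_add, one_div]

theorem irrat_sqrt {D : K[X]} (hD : ¬ IsSquare D) {β : LaurentSeries K}
    (hβ : β ^ 2 = pemb K D) : Irrat β := fun U V hV h =>
  not_isPoly_sqrt hD hβ (isPoly_of_mul_eq (hβ ▸ isPoly_pemb D) (isPoly_pemb U) (isPoly_pemb V)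
    (by rwa [Ne, map_eq_zero_iff _ pemb_injective]) h)

theorem Irrat.mul {β : LaurentSeries K} (h : Irrat β) {P : K[X]} (hP : P ≠ 0) :
    Irrat (pemb K P * β) := fun U V hV hUV =>
  h U (V * P) (mul_ne_zero hV hP) (by rw [map_mul, mul_assoc, hUV])

theorem Irrat.eq_zero {β : LaurentSeries K} (h : Irrat β) {U V : K[X]}
    (hUV : pemb K U + pemb K V * β = 0) : U = 0 ∧ V = 0 := by
  have hV : V = 0 := by
    by_contra hV
    exact h (-U) V hV (by rw [map_neg]; linear_combination hUV)
  refine ⟨pemb_injective ?_, hV⟩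
  rw [hV, map_zero, zero_mul, add_zero] at hUV
  rw [hUV, map_zero]

/-- Complete quotients of an element of `K(T, √D)` stay in that field. -/
theorem exists_cq_eq {D : K[X]} {β : LaurentSeries K} (hβ : β ^ 2 = pemb K D) (hirr : Irrat β)
    {P : K[X]} (hP : P ≠ 0) (n : ℕ) : ∃ A B C : K[X], B ≠ 0 ∧ C ≠ 0 ∧
      cq (pemb K P * β) n = (pemb K A + pemb K B * β) / pemb K C := by
  induction n with
  | zero => exact ⟨0, P, 1, hP, one_ne_zero, by simp [cq]⟩
  | succ n ih =>
    obtain ⟨A, B, C, hB, hC, h⟩ := ih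
    set a := pq (pemb K P * β) n
    have hC' : pemb K C ≠ 0 := by rwa [Ne, map_eq_zero_iff _ pemb_injective]
    have h1 : cq (pemb K P * β) n - pemb K a
        = (pemb K (A - a * C) + pemb K B * β) / pemb K C := by
      rw [h, eq_div_iff hC', sub_mul, div_mul_cancel₀ _ hC', map_sub, map_mul]
      ring
    have h2 : pemb K (A - a * C) + pemb K B * β ≠ 0 := fun h0 => hB (hirr.eq_zero h0).2
    have h3 : pemb K (A - a * C) + pemb K (-B) * β ≠ 0 := fun h0 =>
      hB (neg_eq_zero.1 (hirr.eq_zero h0).2)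
    have h4 : pemb K ((A - a * C) ^ 2 - B ^ 2 * D)
        = (pemb K (A - a * C) + pemb K B * β) * (pemb K (A - a * C) + pemb K (-B) * β) := by
      rw [map_sub (pemb K) ((A - a * C) ^ 2), map_pow, map_mul, map_pow, ← hβ, map_neg]
      ring
    have h5 : pemb K ((A - a * C) ^ 2 - B ^ 2 * D) ≠ 0 := h4 ▸ mul_ne_zero h2 h3
    refine ⟨C * (A - a * C), C * -B, (A - a * C) ^ 2 - B ^ 2 * D, mul_ne_zero hC (neg_ne_zero.2 hB),
      fun h0 => h5 (by rw [h0, map_zero]), ?_⟩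
    rw [cq_succ, h1, inv_div, eq_div_iff h5, h4, map_mul, map_mul]
    field_simp

theorem Irrat.dvd_of_mEquiv {D : K[X]} {β : LaurentSeries K} (hβ : β ^ 2 = pemb K D)
    (hirr : Irrat β) {F G : K[X]}
    (h : MEquiv (pemb K F * β) (pemb K G * β)) : F ∣ G ∧ G ∣ F := by
  obtain ⟨a, b, c, d, ⟨u, hu⟩, h0, h⟩ := h
  rw [emb_eq_pemb] at h h0
  rw [eq_div_iff h0] at h
  have h1 : pemb K (c * F * G * D - b) + pemb K (G * d - a * F) * β = 0 := by
    simp only [map_sub, map_mul, ← hβ]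
    linear_combination h
  obtain ⟨h2, h3⟩ := hirr.eq_zero h1
  have hF : G * ↑u = F * (a ^ 2 - c ^ 2 * G ^ 2 * D) := by
    rw [hu]
    linear_combination a * h3 + G * c * h2
  have hG' : F * ↑u = G * (d ^ 2 - c ^ 2 * F ^ 2 * D) := by
    rw [hu]
    linear_combination -d * h3 + F * c * h2
  exact ⟨(u.dvd_mul_right).1 ⟨_, hF⟩, (u.dvd_mul_right).1 ⟨_, hG'⟩⟩

end Equivalence

section Conclusion

variable {K : Type*} [Field K] [NumberField K]

/-- For every `i` there is a multiple of `√D` by a monic polynomial of degree `d - 1 + 2i` almost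
all of whose partial quotients have degree one. -/
theorem exists_monic_mul {D : K[X]} (hD : ¬ IsSquare D) {n : ℕ} (hd : D.natDegree = 2 * (n + 1))
    {β : LaurentSeries K} (hβ : β ^ 2 = pemb K D) (i : ℕ) :
    ∃ P : K[X], P.Monic ∧ P.natDegree = n + 2 * i ∧
      ∃ N, ∀ m, N ≤ m → (pq (pemb K P * β) m).natDegree = 1 := by
  have hD0 : D ≠ 0 := by
    rintro rfl
    exact hD ⟨0, by simp⟩
  have hXi : (X ^ i : K[X]) ≠ 0 := pow_ne_zero _ X_ne_zero
  have hD' : ¬ IsSquare ((X ^ i) ^ 2 * D) := by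
    rintro ⟨w, hw⟩
    obtain ⟨v, rfl⟩ : X ^ i ∣ w := by
      rw [← IsIntegrallyClosed.pow_dvd_pow_iff two_ne_zero]
      exact ⟨D, by rw [hw, sq]⟩
    refine hD ⟨v, mul_left_cancel₀ (pow_ne_zero 2 hXi) ?_⟩
    rw [hw]
    ring
  have hd' : ((X ^ i) ^ 2 * D).natDegree = 2 * (n + i + 1) := by
    rw [natDegree_mul (pow_ne_zero 2 hXi) hD0, hd, ← pow_mul, natDegree_X_pow]
    ring
  have hβ' : (pemb K (X ^ i) * β) ^ 2 = pemb K ((X ^ i) ^ 2 * D) := by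
    rw [mul_pow, hβ, map_mul, map_pow (pemb K) (X ^ i) 2]
  obtain ⟨lam, hlam⟩ := exists_finite_bad_prod hD' hd' hβ'
  have hmon : (∏ j, (X - C (lam j))).Monic := monic_prod_of_monic _ _ fun j _ => monic_X_sub_C _
  rw [← mul_assoc, ← map_mul] at hlam
  have hPm := hmon.mul (monic_X_pow (R := K) i)
  refine ⟨_, hPm, ?_,
    ((irrat_sqrt hD hβ).mul hPm.ne_zero).eventually_natDegree_eq_one hlam⟩
  rw [hmon.natDegree_mul (monic_X_pow i), natDegree_X_pow,
    natDegree_prod_of_monic _ _ fun j _ => monic_X_sub_C _]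
  simp only [natDegree_X_sub_C, Finset.sum_const, Finset.card_univ, Fintype.card_fin,
    smul_eq_mul]
  ring

end Conclusion

end LaurentCF

open PaperCF in
/-- Over a number field `K`, for every `D ∈ S_K` of degree `2d` the
field `K(T, √D)` contains infinitely many pairwise non-equivalent irrational elements
`α` with `K(α) = 1`; moreover, if `D` is non-Pellian there are `λ₁, …, λ_{d−1} ∈ K`
with `ōK((T − λ₁)⋯(T − λ_{d−1})·√D) = 1` (McMullen's strong conjecture over number
fields). -/
theorem mcmullen_number_field {K : Type*} [Field K] [NumberField K]
    (D : Polynomial K)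
    (hDeven : Even D.natDegree) (hDpos : 0 < D.natDegree)
    (hDnsq : ¬ IsSquare D) (hDlead : IsSquare D.leadingCoeff)
    (β : LaurentSeries K) (hβ : β ^ 2 = emb D) :
    (∃ g : ℕ → LaurentSeries K,
      (∀ i : ℕ, ∃ A B C : Polynomial K, B ≠ 0 ∧ C ≠ 0 ∧
        g i = (emb A + emb B * β) / emb C) ∧
      (∀ i j : ℕ, i ≠ j → ¬ MEquiv (g i) (g j)) ∧
      (∀ i : ℕ, KK (g i) = 1)) ∧
    (¬ Pellian D →
      ∃ lam : Fin (D.natDegree / 2 - 1) → K,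
        KKbar (emb (∏ j : Fin (D.natDegree / 2 - 1),
            (Polynomial.X - Polynomial.C (lam j))) * β) = 1) := by
  rw [LaurentCF.emb_eq_pemb] at *
  have hd : D.natDegree = 2 * (D.natDegree / 2 - 1 + 1) := by
    obtain ⟨k, hk⟩ := hDeven
    omega
  have hirr := LaurentCF.irrat_sqrt hDnsq hβ
  constructor
  · choose P hPm hPd N hN using LaurentCF.exists_monic_mul hDnsq hd hβ
    have hPirr : ∀ i, LaurentCF.Irrat (LaurentCF.pemb K (P i) * β) := fun i =>
      hirr.mul (hPm i).ne_zero
    refine ⟨fun i => cq (LaurentCF.pemb K (P i) * β) (N i), fun i => ?_, fun i j hij h => hij ?_,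
      fun i => (hPirr i).KK_cq_eq_one (hN i)⟩
    · exact LaurentCF.exists_cq_eq hβ hirr (hPm i).ne_zero (N i)
    · have h1 := LaurentCF.mEquiv_trans ((hPirr i).mEquiv_cq (N i))
        (LaurentCF.mEquiv_trans h (LaurentCF.mEquiv_symm ((hPirr j).mEquiv_cq (N j))))
      obtain ⟨h2, h3⟩ := hirr.dvd_of_mEquiv hβ h1
      have h4 := Polynomial.natDegree_le_of_dvd h2 (hPm j).ne_zero
      have h5 := Polynomial.natDegree_le_of_dvd h3 (hPm i).ne_zero
      rw [hPd, hPd] at h4 h5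
      omega
  · intro _
    obtain ⟨lam, hlam⟩ := LaurentCF.exists_finite_bad_prod hDnsq hd hβ
    obtain ⟨N, hN⟩ := (hirr.mul (Polynomial.monic_prod_of_monic Finset.univ _ fun j _ =>
      Polynomial.monic_X_sub_C (lam j)).ne_zero).eventually_natDegree_eq_one hlam
    exact ⟨lam, LaurentCF.KKbar_eq_one hN⟩
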